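/- arXiv:1508.04007 — 14 statements merged into one kernel-verified Lean document; each statement's English description precedes it below -/
import Mathlib

section
/- Let N ≥ 3 be an integer, μ̄ = (N−2)²/4, 0 < μ < μ̄ and σ > 0. Then the function V_σ(x) = C_μ (σ/(σ²|x|^{β₁} + |x|^{β₂}))^{(N−2)/2} satisfies −Δ V_σ(x) − μ V_σ(x)/|x|² = V_σ(x)^{(N+2)/(N−2)} for every x ∈ ℝ^N \ {0}, where Δ denotes the Euclidean Laplacian, i.e. the sum over the coordinate directions of the unmixed second partial derivatives. -/
theorem hasFDerivAt_norm_of_ne_zero {E : Type*} [NormedAddCommGroup E] [InnerProductSpace ℝ E]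
    {x : E} (hx : x ≠ 0) :
    HasFDerivAt (fun y : E => ‖y‖) (‖x‖⁻¹ • innerSL ℝ x) x := by
  have hx' : ‖x‖ ≠ 0 := norm_ne_zero_iff.mpr hx
  have h := ((hasStrictFDerivAt_norm_sq x).hasFDerivAt).sqrt (pow_ne_zero 2 hx')
  simp only [Real.sqrt_sq (norm_nonneg _)] at h
  convert! h using 1
  ext v
  simp
  field_simp

/-- If `g' = r q`, then the Laplacian of `x ↦ g |x|` is `|x| q' + N q` away from the origin. -/
theorem sum_fderiv_fderiv_radial {N : ℕ} {V : EuclideanSpace ℝ (Fin N) → ℝ} {g q q' : ℝ → ℝ}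
    (hV : ∀ x, V x = g ‖x‖) (hg : ∀ r, 0 < r → HasDerivAt g (r * q r) r)
    (hq : ∀ r, 0 < r → HasDerivAt q (q' r) r) {x : EuclideanSpace ℝ (Fin N)} (hx : x ≠ 0) :
    ∑ i : Fin N, fderiv ℝ (fun y => fderiv ℝ V y (EuclideanSpace.single i (1 : ℝ))) x
        (EuclideanSpace.single i (1 : ℝ)) = ‖x‖ * q' ‖x‖ + N * q ‖x‖ := by
  have hx' : 0 < ‖x‖ := norm_pos_iff.mpr hx
  have hfst : ∀ y ≠ 0, ∀ i, fderiv ℝ V y (EuclideanSpace.single i (1 : ℝ)) = q ‖y‖ * y i := by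
    intro y hy i
    have hy' : 0 < ‖y‖ := norm_pos_iff.mpr hy
    have h := (hg _ hy').comp_hasFDerivAt y (hasFDerivAt_norm_of_ne_zero hy)
    rw [show V = g ∘ fun y => ‖y‖ from funext hV, h.fderiv]
    simp [EuclideanSpace.inner_single_right]
    field_simp
  have hsnd : ∀ i, fderiv ℝ (fun y => fderiv ℝ V y (EuclideanSpace.single i (1 : ℝ))) x
      (EuclideanSpace.single i (1 : ℝ)) = q' ‖x‖ / ‖x‖ * x i ^ 2 + q ‖x‖ := by
    intro i
    have he : (fun y => fderiv ℝ V y (EuclideanSpace.single i (1 : ℝ))) =ᶠ[nhds x]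
        fun y => q ‖y‖ * y i := by
      filter_upwards [isOpen_ne.mem_nhds hx] with y hy using hfst y hy i
    have h := ((hq _ hx').comp_hasFDerivAt x (hasFDerivAt_norm_of_ne_zero hx)).mul
      (EuclideanSpace.proj i : EuclideanSpace ℝ (Fin N) →L[ℝ] ℝ).hasFDerivAt
    have h' : HasFDerivAt (fun y : EuclideanSpace ℝ (Fin N) => q ‖y‖ * y i) _ x := h
    rw [he.fderiv_eq, h'.fderiv]
    simp [EuclideanSpace.inner_single_right]
    ring
  simp_rw [hsnd]
  rw [Finset.sum_add_distrib, ← Finset.mul_sum, ← EuclideanSpace.real_norm_sq_eq]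
  simp
  field_simp

/-- The algebra behind the Hardy bubble: `A` and `B` stand for `σ²r^(1-a)` and `r^(1+a)`. -/
theorem radial_bubble_identity {k a A B r f : ℝ} (hr : r ≠ 0) (hD : A + B ≠ 0) :
    -(r * (f * (k * (k + 1) * ((1 - a) * A + (1 + a) * B) ^ 2 / (A + B) ^ 2
      - k * ((1 - a) ^ 2 * A + (1 + a) ^ 2 * B) / (A + B)
      + 2 * k * ((1 - a) * A + (1 + a) * B) / (A + B)) / r ^ 3)
      + (2 * k + 2) * (-k * f * ((1 - a) * A + (1 + a) * B) / (A + B) / r ^ 2))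
      - k ^ 2 * (1 - a ^ 2) * f / r ^ 2
      = 4 * a ^ 2 * k * (k + 1) * (A * B) * f / (A + B) ^ 2 / r ^ 2 := by
  field_simp
  ring

theorem hasDerivAt_bubble_denom {s b c r : ℝ} (hr : 0 < r) :
    HasDerivAt (fun r : ℝ => s * r ^ b + r ^ c) ((b * (s * r ^ b) + c * r ^ c) / r) r := by
  convert! ((Real.hasDerivAt_rpow_const (p := b) (Or.inl hr.ne')).const_mul s).add
    (Real.hasDerivAt_rpow_const (p := c) (Or.inl hr.ne')) using 1
  rw [Real.rpow_sub_one hr.ne', Real.rpow_sub_one hr.ne']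
  field_simp

theorem bubble_pow {k m C t : ℝ} (hk : 0 < k) (hm : 0 < m) (ht : 0 < t) (hC : C = m ^ (k / 2)) :
    (C * t ^ k) ^ ((k + 2) / k) = m * (C * t ^ k) * t ^ 2 := by
  have hC0 : 0 < C := hC ▸ Real.rpow_pos_of_pos hm _
  have htk : 0 < t ^ k := Real.rpow_pos_of_pos ht _
  have hCm : C ^ (2 / k) = m := by
    rw [hC, ← Real.rpow_mul hm.le]
    field_simp
    simp
  have htt : (t ^ k) ^ (2 / k) = t ^ 2 := by
    rw [← Real.rpow_mul ht.le, mul_div_cancel₀ _ hk.ne', Real.rpow_two]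
  rw [show (k + 2) / k = 1 + 2 / k by field_simp, Real.rpow_add (by positivity), Real.rpow_one,
    Real.mul_rpow hC0.le htk.le, hCm, htt]
  ring

/-- The Hardy bubble equation in the parameters `k = (N-2)/2` and `a = √(μ̄-μ)/√μ̄`. -/
theorem radial_bubble_equation {N : ℕ} {k a σ C : ℝ} (hN : (N : ℝ) = 2 * k + 2) (hk : 0 < k)
    (ha : 0 < a) (hσ : 0 < σ) (hC : C = (4 * a ^ 2 * k * (k + 1)) ^ (k / 2))
    {V : EuclideanSpace ℝ (Fin N) → ℝ}
    (hV : ∀ x, V x = C * (σ / (σ ^ 2 * ‖x‖ ^ (1 - a) + ‖x‖ ^ (1 + a))) ^ k)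
    {x : EuclideanSpace ℝ (Fin N)} (hx : x ≠ 0) :
    -(∑ i : Fin N, fderiv ℝ (fun y => fderiv ℝ V y (EuclideanSpace.single i (1 : ℝ))) x
        (EuclideanSpace.single i (1 : ℝ))) - k ^ 2 * (1 - a ^ 2) * V x / ‖x‖ ^ 2 =
      V x ^ ((k + 2) / k) := by
  set D : ℝ → ℝ := fun r => σ ^ 2 * r ^ (1 - a) + r ^ (1 + a)
  set T : ℝ → ℝ := fun r => (1 - a) * (σ ^ 2 * r ^ (1 - a)) + (1 + a) * r ^ (1 + a)
  set U : ℝ → ℝ := fun r => (1 - a) ^ 2 * (σ ^ 2 * r ^ (1 - a)) + (1 + a) ^ 2 * r ^ (1 + a)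
  set g : ℝ → ℝ := fun r => C * (σ / D r) ^ k
  have hDpos : ∀ r, 0 < r → 0 < D r := fun r hr => by simp only [D]; positivity
  have hD : ∀ r, 0 < r → HasDerivAt D (T r / r) r := fun r hr => hasDerivAt_bubble_denom hr
  have hT : ∀ r, 0 < r → HasDerivAt T (U r / r) r := by
    intro r hr
    have h1 := (Real.hasDerivAt_rpow_const (p := 1 - a) (Or.inl hr.ne')).const_mul (σ ^ 2)
      |>.const_mul (1 - a)
    have h2 := (Real.hasDerivAt_rpow_const (p := 1 + a) (Or.inl hr.ne')).const_mul (1 + a)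
    convert! h1.add h2 using 1
    rw [Real.rpow_sub_one hr.ne', Real.rpow_sub_one hr.ne']
    simp only [U]
    field_simp
  have hg : ∀ r, 0 < r → HasDerivAt g (r * (-k * g r * T r / D r / r ^ 2)) r := by
    intro r hr
    have hDr := hDpos r hr
    have hq : σ / D r ≠ 0 := (div_pos hσ hDr).ne'
    convert! ((((hasDerivAt_const r σ).div (hD r hr) hDr.ne').rpow_const (p := k)
      (Or.inl hq)).const_mul C) using 1
    simp only [g, Pi.div_apply]
    rw [Real.rpow_sub_one hq]
    field_simp
    ring
  have hq : ∀ r, 0 < r → HasDerivAt (fun r => -k * g r * T r / D r / r ^ 2)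
      (g r * (k * (k + 1) * T r ^ 2 / D r ^ 2 - k * U r / D r + 2 * k * T r / D r) / r ^ 3) r := by
    intro r hr
    have hDr := hDpos r hr
    convert! ((((hg r hr).const_mul (-k)).mul (hT r hr)).div (hD r hr) hDr.ne').div
      (hasDerivAt_pow 2 r) (pow_ne_zero 2 hr.ne') using 1
    simp
    field_simp
    ring
  have hr : 0 < ‖x‖ := norm_pos_iff.mpr hx
  have hAB : σ ^ 2 * ‖x‖ ^ (1 - a) * ‖x‖ ^ (1 + a) = σ ^ 2 * ‖x‖ ^ 2 := by
    rw [mul_assoc, ← Real.rpow_add hr, ← Real.rpow_two]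
    norm_num
  rw [sum_fderiv_fderiv_radial hV hg hq hx, hN, hV x]
  have hDx := hDpos _ hr
  have key := radial_bubble_identity (k := k) (a := a) (f := g ‖x‖) hr.ne' hDx.ne'
  rw [hAB] at key
  rw [bubble_pow hk (by positivity) (div_pos hσ hDx) hC]
  refine key.trans ?_
  change _ / D ‖x‖ ^ 2 / _ = _ * g ‖x‖ * _
  field_simp

/-- For `0 < μ < μ̄ = (N−2)²/4` and `σ > 0`, the Hardy bubble
`V_σ(x) = C_μ (σ/(σ²|x|^{β₁} + |x|^{β₂}))^{(N−2)/2}` satisfies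
`−Δ V_σ − μ V_σ/|x|² = V_σ^{(N+2)/(N−2)}` on `ℝ^N \ {0}`. -/
theorem hardy_bubble_solves_equation (N : ℕ) (hN : 3 ≤ N) (μ σ : ℝ)
    (hμ : 0 < μ) (hμ' : μ < ((N : ℝ) - 2) ^ 2 / 4) (hσ : 0 < σ)
    (β₁ β₂ Cμ : ℝ)
    (hβ₁ : β₁ = (Real.sqrt (((N : ℝ) - 2) ^ 2 / 4) -
        Real.sqrt (((N : ℝ) - 2) ^ 2 / 4 - μ)) / Real.sqrt (((N : ℝ) - 2) ^ 2 / 4))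
    (hβ₂ : β₂ = (Real.sqrt (((N : ℝ) - 2) ^ 2 / 4) +
        Real.sqrt (((N : ℝ) - 2) ^ 2 / 4 - μ)) / Real.sqrt (((N : ℝ) - 2) ^ 2 / 4))
    (hC : Cμ = (4 * (N : ℝ) * (((N : ℝ) - 2) ^ 2 / 4 - μ) / ((N : ℝ) - 2)) ^ (((N : ℝ) - 2) / 4))
    (V : EuclideanSpace ℝ (Fin N) → ℝ)
    (hV : ∀ x, V x = Cμ * (σ / (σ ^ 2 * ‖x‖ ^ β₁ + ‖x‖ ^ β₂)) ^ (((N : ℝ) - 2) / 2)) :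
    ∀ x : EuclideanSpace ℝ (Fin N), x ≠ 0 →
      -(∑ i : Fin N,
          fderiv ℝ (fun y => fderiv ℝ V y (EuclideanSpace.single i (1 : ℝ))) x
            (EuclideanSpace.single i (1 : ℝ))) -
        μ * V x / ‖x‖ ^ 2 =
        V x ^ (((N : ℝ) + 2) / ((N : ℝ) - 2)) := by
  intro x hx
  have hN' : (3 : ℝ) ≤ N := by exact_mod_cast hN
  obtain ⟨k, hk⟩ : ∃ k : ℝ, k = ((N : ℝ) - 2) / 2 := ⟨_, rfl⟩
  have hk0 : 0 < k := by linarith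
  have hNk : (N : ℝ) = 2 * k + 2 := by linarith
  have hμbar : ((N : ℝ) - 2) ^ 2 / 4 = k ^ 2 := by rw [hk]; ring
  rw [hμbar] at hμ' hβ₁ hβ₂ hC
  rw [Real.sqrt_sq hk0.le] at hβ₁ hβ₂
  obtain ⟨a, ha⟩ : ∃ a : ℝ, a = √(k ^ 2 - μ) / k := ⟨_, rfl⟩
  have ha0 : 0 < a := ha ▸ div_pos (Real.sqrt_pos.mpr (sub_pos.mpr hμ')) hk0
  have hka : k ^ 2 - μ = k ^ 2 * a ^ 2 := by
    rw [ha, div_pow, Real.sq_sqrt (sub_pos.mpr hμ').le]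
    field_simp
  have hb₁ : β₁ = 1 - a := by rw [hβ₁, ha]; field_simp
  have hb₂ : β₂ = 1 + a := by rw [hβ₂, ha]; field_simp
  have hC' : Cμ = (4 * a ^ 2 * k * (k + 1)) ^ (k / 2) := by
    rw [hC, hka, hNk, show 2 * k + 2 - 2 = 2 * k by ring]
    congr 1
    · field_simp
    · ring
  rw [hb₁, hb₂, ← hk] at hV
  have h := radial_bubble_equation hNk hk0 ha0 hσ hC' hV hx
  rw [show k ^ 2 * (1 - a ^ 2) = μ by linarith] at h
  rw [h, hNk, show 2 * k + 2 - 2 = 2 * k by ring]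
  congr 1
  field_simp
  ring
end

section
/- Let N ≥ 7 be an integer, μ̄ = (N−2)²/4, and for 0 < μ < μ̄ let V₁^{(μ)}(x) = C_μ (1/(|x|^{β₁} + |x|^{β₂}))^{(N−2)/2} (the Hardy bubble with σ = 1). Then, as μ → 0⁺, the integral ∫_{ℝ^N} (V₁^{(μ)}(x))^{2*} dx converges to ∫_{ℝ^N} U_{1,0}(x)^{2*} dx, where 2* = 2N/(N−2) and U_{1,0}(x) = C₀ (1/(1 + |x|²))^{(N−2)/2}. -/
open MeasureTheory

/-- The envelope `1 / max (r ^ (1/4)) (r ^ (7/4))`, raised to the dimension, is integrable. -/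
lemma integrable_one_div_max_rpow_norm (N : ℕ) (hN : 7 ≤ N) :
    Integrable (fun x : EuclideanSpace ℝ (Fin N) =>
      (1 / max (‖x‖ ^ (1 / 4 : ℝ)) (‖x‖ ^ (7 / 4 : ℝ))) ^ (N : ℝ)) := by
  have : Nonempty (Fin N) := ⟨⟨0, by omega⟩⟩
  have hNR : (7 : ℝ) ≤ N := by exact_mod_cast hN
  rw [integrable_fun_norm_addHaar volume
    (f := fun r : ℝ => (1 / max (r ^ (1 / 4 : ℝ)) (r ^ (7 / 4 : ℝ))) ^ (N : ℝ))]
  have hmeas : Measurable (fun r : ℝ => r ^ (Module.finrank ℝ (EuclideanSpace ℝ (Fin N)) - 1) •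
      (1 / max (r ^ (1 / 4 : ℝ)) (r ^ (7 / 4 : ℝ))) ^ (N : ℝ)) := by
    simp only [smul_eq_mul]
    fun_prop
  have key : ∀ (e r : ℝ), 0 < r → r ^ e ≤ max (r ^ (1 / 4 : ℝ)) (r ^ (7 / 4 : ℝ)) →
      ‖r ^ (Module.finrank ℝ (EuclideanSpace ℝ (Fin N)) - 1) •
        (1 / max (r ^ (1 / 4 : ℝ)) (r ^ (7 / 4 : ℝ))) ^ (N : ℝ)‖ ≤ r ^ ((N : ℝ) - 1 - e * N) := by
    intro e r hr he
    have hre := Real.rpow_pos_of_pos hr e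
    rw [one_div (max _ _), smul_eq_mul,
      finrank_euclideanSpace_fin, Real.norm_of_nonneg (by positivity),
      Real.rpow_sub hr, ← Real.rpow_natCast, Nat.cast_sub (by omega), Nat.cast_one,
      div_eq_mul_inv (r ^ ((N : ℝ) - 1)), Real.rpow_mul hr.le e, ← Real.inv_rpow hre.le]
    gcongr
  rw [← Set.Ioc_union_Ioi_eq_Ioi (zero_le_one (α := ℝ))]
  refine IntegrableOn.union ?_ ?_
  · refine Measure.integrableOn_of_bounded (M := 1) (by simp) hmeas.aestronglyMeasurable ?_
    filter_upwards [ae_restrict_mem measurableSet_Ioc] with r hr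
    exact (key (1 / 4) r hr.1 (le_max_left _ _)).trans
      (Real.rpow_le_one hr.1.le hr.2 (by linarith))
  · refine (integrableOn_Ioi_rpow_of_lt (a := (N : ℝ) - 1 - 7 / 4 * N) (by linarith)
      one_pos).mono' hmeas.aestronglyMeasurable ?_
    filter_upwards [ae_restrict_mem measurableSet_Ioi] with r hr
    exact key (7 / 4) r (one_pos.trans hr) (le_max_right _ _)

lemma max_rpow_le_add_rpow {r b c : ℝ} (hr : 0 < r) (hb : b ≤ 1 / 4) (hc : 7 / 4 ≤ c) :
    max (r ^ (1 / 4 : ℝ)) (r ^ (7 / 4 : ℝ)) ≤ r ^ b + r ^ c := by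
  have hb0 := Real.rpow_pos_of_pos hr b
  have hc0 := Real.rpow_pos_of_pos hr c
  rcases le_total r 1 with h | h
  · have h1 := Real.rpow_le_rpow_of_exponent_ge hr h hb
    have h2 := Real.rpow_le_rpow_of_exponent_ge hr h (by norm_num : (1 / 4 : ℝ) ≤ 7 / 4)
    exact max_le (by linarith) (by linarith)
  · have h1 := Real.rpow_le_rpow_of_exponent_le h hc
    have h2 := Real.rpow_le_rpow_of_exponent_le h (by norm_num : (1 / 4 : ℝ) ≤ 7 / 4)
    exact max_le (by linarith) (by linarith)

/-- As `μ → 0⁺`, `∫_{ℝ^N} (V₁^{(μ)})^{2*} → ∫_{ℝ^N} U_{1,0}^{2*}`. -/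
theorem hardy_bubble_integral_limit (N : ℕ) (hN : 7 ≤ N) :
    Filter.Tendsto
      (fun μ : ℝ => ∫ x : EuclideanSpace ℝ (Fin N),
        ((4 * (N : ℝ) * (((N : ℝ) - 2) ^ 2 / 4 - μ) / ((N : ℝ) - 2)) ^ (((N : ℝ) - 2) / 4) *
            (1 / (‖x‖ ^ ((Real.sqrt (((N : ℝ) - 2) ^ 2 / 4) -
                  Real.sqrt (((N : ℝ) - 2) ^ 2 / 4 - μ)) / Real.sqrt (((N : ℝ) - 2) ^ 2 / 4)) +
                ‖x‖ ^ ((Real.sqrt (((N : ℝ) - 2) ^ 2 / 4) +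
                  Real.sqrt (((N : ℝ) - 2) ^ 2 / 4 - μ)) / Real.sqrt (((N : ℝ) - 2) ^ 2 / 4)))) ^
              (((N : ℝ) - 2) / 2)) ^ (2 * (N : ℝ) / ((N : ℝ) - 2)))
      (nhdsWithin 0 (Set.Ioi 0))
      (nhds (∫ x : EuclideanSpace ℝ (Fin N),
        (((N : ℝ) * ((N : ℝ) - 2)) ^ (((N : ℝ) - 2) / 4) *
            (1 / (1 + ‖x‖ ^ 2)) ^ (((N : ℝ) - 2) / 2)) ^ (2 * (N : ℝ) / ((N : ℝ) - 2)))) := by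
  have hNR : (7 : ℝ) ≤ N := by exact_mod_cast hN
  have : Nonempty (Fin N) := ⟨⟨0, by omega⟩⟩
  have hn2 : (0 : ℝ) < (N : ℝ) - 2 := by linarith
  have hs : 0 < Real.sqrt (((N : ℝ) - 2) ^ 2 / 4) := by positivity
  have hA : Filter.Tendsto (fun μ : ℝ => 4 * (N : ℝ) * (((N : ℝ) - 2) ^ 2 / 4 - μ) / ((N : ℝ) - 2))
      (nhdsWithin 0 (Set.Ioi 0)) (nhds ((N : ℝ) * ((N : ℝ) - 2))) := by
    have h : Continuous (fun μ : ℝ =>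
      4 * (N : ℝ) * (((N : ℝ) - 2) ^ 2 / 4 - μ) / ((N : ℝ) - 2)) := by fun_prop
    convert (h.tendsto 0).mono_left nhdsWithin_le_nhds using 2
    field_simp
    ring
  have hb : Filter.Tendsto (fun μ : ℝ => (Real.sqrt (((N : ℝ) - 2) ^ 2 / 4) -
      Real.sqrt (((N : ℝ) - 2) ^ 2 / 4 - μ)) / Real.sqrt (((N : ℝ) - 2) ^ 2 / 4))
      (nhdsWithin 0 (Set.Ioi 0)) (nhds 0) := by
    have h : Continuous (fun μ : ℝ => (Real.sqrt (((N : ℝ) - 2) ^ 2 / 4) -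
      Real.sqrt (((N : ℝ) - 2) ^ 2 / 4 - μ)) / Real.sqrt (((N : ℝ) - 2) ^ 2 / 4)) := by fun_prop
    convert (h.tendsto 0).mono_left nhdsWithin_le_nhds using 2
    simp
  have hc : Filter.Tendsto (fun μ : ℝ => (Real.sqrt (((N : ℝ) - 2) ^ 2 / 4) +
      Real.sqrt (((N : ℝ) - 2) ^ 2 / 4 - μ)) / Real.sqrt (((N : ℝ) - 2) ^ 2 / 4))
      (nhdsWithin 0 (Set.Ioi 0)) (nhds 2) := by
    have h : Continuous (fun μ : ℝ => (Real.sqrt (((N : ℝ) - 2) ^ 2 / 4) +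
      Real.sqrt (((N : ℝ) - 2) ^ 2 / 4 - μ)) / Real.sqrt (((N : ℝ) - 2) ^ 2 / 4)) := by fun_prop
    convert (h.tendsto 0).mono_left nhdsWithin_le_nhds using 2
    rw [sub_zero, ← two_mul, mul_div_assoc, div_self hs.ne', mul_one]
  have hx0 : ∀ᵐ x : EuclideanSpace ℝ (Fin N), x ≠ 0 := Measure.ae_ne volume 0
  refine tendsto_integral_filter_of_dominated_convergence
    (fun x => (((N : ℝ) * ((N : ℝ) - 2) + 1) ^ (((N : ℝ) - 2) / 4) *
      (1 / max (‖x‖ ^ (1 / 4 : ℝ)) (‖x‖ ^ (7 / 4 : ℝ))) ^ (((N : ℝ) - 2) / 2)) ^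
        (2 * (N : ℝ) / ((N : ℝ) - 2))) ?_ ?_ ?_ ?_
  · refine Filter.Eventually.of_forall fun μ => Measurable.aestronglyMeasurable ?_
    fun_prop
  · filter_upwards [hA.eventually_le_const (lt_add_one _),
      hA.eventually_const_le (show (0 : ℝ) < (N : ℝ) * ((N : ℝ) - 2) by positivity),
      hb.eventually_le_const (show (0 : ℝ) < 1 / 4 by norm_num),
      hc.eventually_const_le (show (7 / 4 : ℝ) < 2 by norm_num)] with μ h1 h2 h3 h4
    filter_upwards [hx0] with x hx
    have hr := norm_pos_iff.mpr hx
    have hle := max_rpow_le_add_rpow hr h3 h4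
    rw [Real.norm_of_nonneg (by positivity)]
    gcongr
  · have h := (integrable_one_div_max_rpow_norm N hN).const_mul
      ((((N : ℝ) * ((N : ℝ) - 2) + 1) ^ (((N : ℝ) - 2) / 4)) ^ (2 * (N : ℝ) / ((N : ℝ) - 2)))
    convert h using 2 with x
    rw [Real.mul_rpow (by positivity) (by positivity), ← Real.rpow_mul (x := 1 / _) (by positivity)]
    congr 2
    field_simp
  · filter_upwards [hx0] with x hx
    have hr := norm_pos_iff.mpr hx
    have hp : 0 ≤ 2 * (N : ℝ) / ((N : ℝ) - 2) := by positivity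
    have hbx := (tendsto_const_nhds (x := ‖x‖)).rpow hb (Or.inl hr.ne')
    have hcx := (tendsto_const_nhds (x := ‖x‖)).rpow hc (Or.inl hr.ne')
    rw [Real.rpow_zero] at hbx
    rw [Real.rpow_two] at hcx
    exact ((hA.rpow_const (Or.inr (by positivity))).mul
      (((tendsto_const_nhds (x := (1 : ℝ))).div (hbx.add hcx) (by positivity)).rpow_const
        (Or.inr (by positivity)))).rpow_const (Or.inr hp)
end

section
/- Let H₀, h, g, G, b > 0 be real numbers and suppose x, y, z > 0 satisfy the three equations: H₀ z² + g x z + g y z = b; h x² + g x z − G x y = b; h y² + g y z − G x y = b. Then x = y, the quantity h − G is strictly positive, z = α x where α = (−g + √(g² + 4H₀(h − G)))/(2H₀), and x² = b/β where β = h − G + g α. -/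
/-- The algebraic content of Lemma 3.5 in the case `k = 2`. -/
theorem lemma35_k2 (H₀ h g G b x y z : ℝ)
    (hH₀ : 0 < H₀) (hh : 0 < h) (hg : 0 < g) (hG : 0 < G) (hb : 0 < b)
    (hx : 0 < x) (hy : 0 < y) (hz : 0 < z)
    (e1 : H₀ * z ^ 2 + g * x * z + g * y * z = b)
    (e2 : h * x ^ 2 + g * x * z - G * x * y = b)
    (e3 : h * y ^ 2 + g * y * z - G * x * y = b) :
    x = y ∧ 0 < h - G ∧
    z = (-g + Real.sqrt (g ^ 2 + 4 * H₀ * (h - G))) / (2 * H₀) * x ∧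
    x ^ 2 = b / (h - G + g * ((-g + Real.sqrt (g ^ 2 + 4 * H₀ * (h - G))) / (2 * H₀))) := by
  have hxy : x = y := by
    have hfac : (x - y) * (h * (x + y) + g * z) = 0 := by linear_combination e2 - e3
    have hpos : h * (x + y) + g * z ≠ 0 := by positivity
    exact sub_eq_zero.mp ((mul_eq_zero.mp hfac).resolve_right hpos)
  subst hxy
  obtain ⟨t, ht, rfl⟩ : ∃ t, 0 < t ∧ z = t * x := ⟨z / x, by positivity, by field_simp⟩
  have hquad : h - G = H₀ * t ^ 2 + g * t :=
    mul_right_cancel₀ (pow_ne_zero 2 hx.ne') (by linear_combination e2 - e1)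
  have hroot : (-g + √(g ^ 2 + 4 * H₀ * (h - G))) / (2 * H₀) = t := by
    have hsq : g ^ 2 + 4 * H₀ * (h - G) = (2 * H₀ * t + g) ^ 2 := by rw [hquad]; ring
    rw [hsq, Real.sqrt_sq (by positivity)]
    field_simp
    ring
  have hpos : 0 < h - G := by rw [hquad]; positivity
  refine ⟨rfl, hpos, by rw [hroot], ?_⟩
  rw [hroot, eq_div_iff (by positivity)]
  linear_combination e2
end

section
/- Let H₀, h, g, G, b > 0 be real numbers and suppose x₁, x₂, x₃, z > 0 satisfy the four equations: H₀ z² + g (x₁ + x₂ + x₃) z = b, and for each i ∈ {1,2,3}, h xᵢ² + g xᵢ z − G xᵢ (xⱼ + x_k) = b, where {i,j,k} = {1,2,3}. Then x₁ = x₂ = x₃; moreover, writing x for the common value, h − 2G > 0, z = α x where α = (−2g + √(4g² + 4H₀(h − 2G)))/(2H₀), and x² = b/β where β = h − 2G + g α. -/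
/-- A quadratic with positive leading coefficient and negative constant term has at most one
positive root. -/
theorem eq_of_pos_of_quadratic_eq {A B b x y : ℝ} (hA : 0 < A) (hb : 0 < b) (hx : 0 < x)
    (hy : 0 < y) (ex : A * x ^ 2 + B * x = b) (ey : A * y ^ 2 + B * y = b) : x = y := by
  have hpos : 0 < A * x + B := by
    refine pos_of_mul_pos_right (a := x) ?_ hx.le
    linarith
  have hprod : (x - y) * (A * x + B + A * y) = 0 := by linear_combination ex - ey
  have hne : A * x + B + A * y ≠ 0 := by positivity
  exact sub_eq_zero.mp ((mul_eq_zero.mp hprod).resolve_right hne)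

/-- The algebraic content of Lemma 3.5 in the case `k = 3`. -/
theorem lemma35_k3 (H₀ h g G b x₁ x₂ x₃ z : ℝ)
    (hH₀ : 0 < H₀) (hh : 0 < h) (hg : 0 < g) (hG : 0 < G) (hb : 0 < b)
    (hx₁ : 0 < x₁) (hx₂ : 0 < x₂) (hx₃ : 0 < x₃) (hz : 0 < z)
    (e0 : H₀ * z ^ 2 + g * (x₁ + x₂ + x₃) * z = b)
    (e1 : h * x₁ ^ 2 + g * x₁ * z - G * x₁ * (x₂ + x₃) = b)
    (e2 : h * x₂ ^ 2 + g * x₂ * z - G * x₂ * (x₁ + x₃) = b)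
    (e3 : h * x₃ ^ 2 + g * x₃ * z - G * x₃ * (x₁ + x₂) = b) :
    x₁ = x₂ ∧ x₂ = x₃ ∧ 0 < h - 2 * G ∧
    z = (-(2 * g) + Real.sqrt (4 * g ^ 2 + 4 * H₀ * (h - 2 * G))) / (2 * H₀) * x₁ ∧
    x₁ ^ 2 = b / (h - 2 * G +
      g * ((-(2 * g) + Real.sqrt (4 * g ^ 2 + 4 * H₀ * (h - 2 * G))) / (2 * H₀))) := by
  have hA : 0 < h + G := by positivity
  have h12 : x₁ = x₂ :=
    eq_of_pos_of_quadratic_eq (A := h + G) (B := g * z - G * (x₁ + x₂ + x₃)) hA hb hx₁ hx₂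
      (by linear_combination e1) (by linear_combination e2)
  have h23 : x₂ = x₃ :=
    eq_of_pos_of_quadratic_eq (A := h + G) (B := g * z - G * (x₁ + x₂ + x₃)) hA hb hx₂ hx₃
      (by linear_combination e2) (by linear_combination e3)
  subst h12 h23
  obtain ⟨a, rfl⟩ : ∃ a, z = a * x₁ := ⟨z / x₁, by field_simp⟩
  have ha : 0 < a := pos_of_mul_pos_left hz hx₁.le
  have hquad : h - 2 * G = H₀ * a ^ 2 + 2 * g * a := by
    refine mul_right_cancel₀ (pow_pos hx₁ 2).ne' ?_
    linear_combination e1 - e0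
  have hroot : (-(2 * g) + Real.sqrt (4 * g ^ 2 + 4 * H₀ * (h - 2 * G))) / (2 * H₀) = a := by
    have hsq : 4 * g ^ 2 + 4 * H₀ * (h - 2 * G) = (2 * g + 2 * H₀ * a) ^ 2 := by
      rw [hquad]; ring
    rw [hsq, Real.sqrt_sq (by positivity)]
    field_simp
    ring
  have hpos : 0 < h - 2 * G := by rw [hquad]; positivity
  refine ⟨rfl, rfl, hpos, by rw [hroot], ?_⟩
  rw [hroot, eq_div_iff (by positivity)]
  linear_combination e1
end

section
/- Let H₀, h, g, G₁, G₂, b > 0 be real numbers and suppose x₁, x₂, x₃, x₄, z > 0 satisfy the five equations: H₀ z² + g (x₁ + x₂ + x₃ + x₄) z = b, and for each i ∈ {1,2,3,4} (indices taken cyclically mod 4), h xᵢ² + g xᵢ z − G₁ xᵢ (x_{i−1} + x_{i+1}) − G₂ xᵢ x_{i+2} = b. Then x₁ = x₂ = x₃ = x₄; moreover, writing x for the common value, h − 2G₁ − G₂ > 0, z = α x where α = (−3g + √(9g² + 4H₀(h − 2G₁ − G₂)))/(2H₀), and x² = b/β where β = h − 2G₁ − G₂ + g α. -/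
/-- The equation `K * t ^ 2 + u * t = b` with `K` and `b` positive has at most one positive root. -/
theorem eq_of_mul_add_eq {K u b x y : ℝ} (hK : 0 < K) (hb : 0 < b) (hx : 0 < x) (hy : 0 < y)
    (ex : K * x ^ 2 + u * x = b) (ey : K * y ^ 2 + u * y = b) : x = y := by
  have h : (x - y) * (K * x * y + b) = 0 := by linear_combination y * ex - x * ey
  have hpos : 0 < K * x * y + b := by positivity
  rcases mul_eq_zero.mp h with h | h <;> linarith

/-- The two-parameter system obtained by identifying opposite vertices forces the two remaining
values to agree. -/
theorem eq_of_alternating {H g A G b p q z : ℝ} (hH : 0 < H) (hg : 0 < g) (hG : 0 < G)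
    (hp : 0 < p) (hq : 0 < q) (hz : 0 < z)
    (e0 : H * z ^ 2 + 2 * g * (p + q) * z = b)
    (ep : A * p ^ 2 + g * p * z - 2 * G * p * q = b)
    (eq' : A * q ^ 2 + g * q * z - 2 * G * q * p = b) : p = q := by
  by_contra hne
  have hsub : p - q ≠ 0 := sub_ne_zero.mpr hne
  have h1 : (A + 2 * G) * (p * q) + b = 0 := by
    apply (mul_eq_zero.mp _).resolve_left hsub
    linear_combination q * ep - p * eq'
  have h2 : A * (p + q) + g * z = 0 := by
    apply (mul_eq_zero.mp _).resolve_left hp.ne'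
    linear_combination ep + h1
  have h3 : b * (p + q) = g * z * (p * q) - 2 * G * (p * q) * (p + q) := by
    linear_combination (p + q) * h1 - p * q * h2
  rw [← e0] at h3
  have h4 : 0 < H * z ^ 2 * (p + q) + g * z * (2 * p ^ 2 + 2 * q ^ 2 + 3 * (p * q))
      + 2 * G * (p * q) * (p + q) := by positivity
  linarith

/-- A positive root of a quadratic with positive leading coefficient and nonnegative linear
coefficient is given by the quadratic formula with the plus sign. -/
theorem eq_quadratic_formula_of_pos {H c C s : ℝ} (hH : 0 < H) (hc : 0 ≤ c) (hs : 0 < s)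
    (h : H * s ^ 2 + c * s = C) : s = (-c + √(c ^ 2 + 4 * H * C)) / (2 * H) := by
  have hsq : c ^ 2 + 4 * H * C = (2 * H * s + c) ^ 2 := by rw [← h]; ring
  rw [hsq, Real.sqrt_sq (by positivity)]
  field_simp
  ring

/-- The algebraic content of Lemma 3.5 in the case `k = 4`. -/
theorem lemma35_k4 (H₀ h g G₁ G₂ b x₁ x₂ x₃ x₄ z : ℝ)
    (hH₀ : 0 < H₀) (hh : 0 < h) (hg : 0 < g) (hG₁ : 0 < G₁) (hG₂ : 0 < G₂) (hb : 0 < b)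
    (hx₁ : 0 < x₁) (hx₂ : 0 < x₂) (hx₃ : 0 < x₃) (hx₄ : 0 < x₄) (hz : 0 < z)
    (e0 : H₀ * z ^ 2 + g * (x₁ + x₂ + x₃ + x₄) * z = b)
    (e1 : h * x₁ ^ 2 + g * x₁ * z - G₁ * x₁ * (x₄ + x₂) - G₂ * x₁ * x₃ = b)
    (e2 : h * x₂ ^ 2 + g * x₂ * z - G₁ * x₂ * (x₁ + x₃) - G₂ * x₂ * x₄ = b)
    (e3 : h * x₃ ^ 2 + g * x₃ * z - G₁ * x₃ * (x₂ + x₄) - G₂ * x₃ * x₁ = b)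
    (e4 : h * x₄ ^ 2 + g * x₄ * z - G₁ * x₄ * (x₃ + x₁) - G₂ * x₄ * x₂ = b) :
    x₁ = x₂ ∧ x₂ = x₃ ∧ x₃ = x₄ ∧ 0 < h - 2 * G₁ - G₂ ∧
    z = (-(3 * g) + Real.sqrt (9 * g ^ 2 + 4 * H₀ * (h - 2 * G₁ - G₂))) / (2 * H₀) * x₁ ∧
    x₁ ^ 2 = b / (h - 2 * G₁ - G₂ +
      g * ((-(3 * g) + Real.sqrt (9 * g ^ 2 + 4 * H₀ * (h - 2 * G₁ - G₂))) / (2 * H₀))) := by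
  have h13 : x₁ = x₃ := eq_of_mul_add_eq (K := h + G₂)
    (u := g * z - G₁ * (x₂ + x₄) - G₂ * (x₁ + x₃)) (by positivity) hb hx₁ hx₃
    (by linear_combination e1) (by linear_combination e3)
  have h24 : x₂ = x₄ := eq_of_mul_add_eq (K := h + G₂)
    (u := g * z - G₁ * (x₁ + x₃) - G₂ * (x₂ + x₄)) (by positivity) hb hx₂ hx₄
    (by linear_combination e2) (by linear_combination e4)
  subst h13 h24
  have h12 : x₁ = x₂ := eq_of_alternating (A := h - G₂) (b := b) hH₀ hg hG₁ hx₁ hx₂ hz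
    (by linear_combination e0) (by linear_combination e1) (by linear_combination e2)
  subst h12
  have hC : H₀ * (z / x₁) ^ 2 + 3 * g * (z / x₁) = h - 2 * G₁ - G₂ := by
    field_simp
    linear_combination e0 - e1
  have hα := eq_quadratic_formula_of_pos hH₀ (by positivity) (div_pos hz hx₁) hC
  rw [show (3 * g) ^ 2 = 9 * g ^ 2 by ring] at hα
  have hCpos : 0 < h - 2 * G₁ - G₂ := by rw [← hC]; positivity
  rw [← hα]
  refine ⟨rfl, rfl, rfl, hCpos, by field_simp, ?_⟩
  rw [eq_div_iff (by positivity)]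
  field_simp
  linear_combination e1
end

section
/- Let N ≥ 7 be an integer and let t ∈ (0,1) satisfy γ₂(t) ≥ 0. Then ι₂(t) > 0, where ι₂(t) = γ₂′(t) + 2 α₃(t) τ₁′(t), with γ₂′ and τ₁′ the derivatives of γ₂ and τ₁, and α₃(t) = (−3τ₁(t) + √(9τ₁(t)² + 4γ₂(t)))/2. (In particular, ι₂ has no zero on the interval (t*, 1), where t* is the unique zero of γ₂ in (0,1).) -/
/-- Derivative of a constant over a natural power of a nonvanishing function. -/
theorem HasDerivAt.const_div_pow {f : ℝ → ℝ} {f' x : ℝ} (k : ℝ) (n : ℕ)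
    (hf : HasDerivAt f f' x) (hx : f x ≠ 0) :
    HasDerivAt (fun s => k / f s ^ n) (-(n * (k * f' / f x) * (1 / f x ^ n))) x := by
  have h := ((hf.fun_pow n).fun_inv (pow_ne_zero n hx)).const_mul k
  simp only [← div_eq_mul_inv] at h
  refine h.congr_deriv ?_
  rcases n with _ | n
  · simp
  · rw [Nat.add_sub_cancel]
    field_simp
    ring

/-- The nonnegative root of `α² + 3 τ α = γ` is at most `γ / (3 τ)`. -/
theorem half_neg_add_sqrt_le {τ γ : ℝ} (hτ : 0 < τ) (hγ : 0 ≤ γ) :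
    (-(3 * τ) + Real.sqrt (9 * τ ^ 2 + 4 * γ)) / 2 ≤ γ / (3 * τ) := by
  have h : Real.sqrt (9 * τ ^ 2 + 4 * γ) ≤ 3 * τ + 2 * (γ / (3 * τ)) := by
    rw [Real.sqrt_le_left (by positivity)]
    have h1 : τ * (γ / (3 * τ)) = γ / 3 := by field_simp
    nlinarith [sq_nonneg (γ / (3 * τ))]
  linarith

/-- Comparison of reciprocal powers of positive reals. -/
theorem one_div_pow_le_mul_one_div_pow {a t b : ℝ} (n : ℕ) (ha : 0 < a) (ht : 0 < t)
    (h : a * t ≤ b) : 1 / b ^ n ≤ 1 / a ^ n * (1 / t ^ n) := by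
  rw [one_div_mul_one_div, ← mul_pow]
  exact one_div_le_one_div_of_le (by positivity) (pow_le_pow_left₀ (by positivity) h n)

theorem two_mul_one_div_two_pow_lt {n : ℕ} (hn : 5 ≤ n) :
    2 * (1 / (2 : ℝ) ^ n) < 1 / Real.sqrt 2 ^ n := by
  have h4 : Real.sqrt 2 ^ 4 = 4 := by
    rw [show 4 = 2 * 2 from rfl, pow_mul, Real.sq_sqrt (by norm_num)]; norm_num
  have h1 : (4 : ℝ) ≤ Real.sqrt 2 ^ n := by
    rw [← h4]
    exact pow_le_pow_right₀ (Real.one_le_sqrt.2 (by norm_num)) (by omega)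
  have h2 : (2 : ℝ) ^ n = Real.sqrt 2 ^ n * Real.sqrt 2 ^ n := by
    rw [← mul_pow, Real.mul_self_sqrt (by norm_num)]
  rw [h2, mul_one_div, div_lt_div_iff₀ (by positivity) (by positivity)]
  nlinarith

/-- The inequality of `iota2_positive` in terms of the reciprocal powers occurring in `τ` and `γ`. -/
theorem rational_bound {t W P A B R Q : ℝ} (ht0 : 0 < t) (ht1 : t < 1)
    (hW : 1 ≤ t ^ 4 * W) (hP : 0 < P) (hR : 0 < R) (hQ : 0 < Q)
    (hRA : R ≤ A * W) (hQB : Q ≤ B * W) (hs : 1 + t ^ 4 < 4 * t ^ 2) :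
    2 * ((P - 2 * (A * W) + 2 * R - B * W + Q) / (3 * (W - 1))) * W <
      2 * t ^ 2 * P / (1 - t ^ 2) + 2 * (A * W) - 4 * t ^ 4 * R / (t ^ 4 + 1) + B * W
        - 2 * t ^ 2 * Q / (t ^ 2 + 1) := by
  have hs1 : t ^ 2 < 1 := by nlinarith
  have ht4 : t ^ 4 < 1 := by nlinarith
  have hW1 : 1 < W := by
    by_contra! h
    nlinarith [pow_pos ht0 4]
  have hW0 : 0 < W - 1 := by linarith
  have hs0 : 0 < 1 - t ^ 2 := by linarith
  have h1 : 4 * t ^ 4 * R / (t ^ 4 + 1) < 2 * R := by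
    rw [div_lt_iff₀ (by positivity)]; nlinarith
  have h2 : 2 * t ^ 2 * Q / (t ^ 2 + 1) < Q := by
    rw [div_lt_iff₀ (by positivity)]; nlinarith
  have h3 : 2 * (P / (3 * (W - 1))) * W ≤ 2 * t ^ 2 * P / (1 - t ^ 2) := by
    have h4 : (1 - t ^ 2) * W ≤ 3 * t ^ 2 * (W - 1) := by
      have h5 : 1 ≤ 3 * t ^ 2 * (1 + t ^ 2) := by nlinarith
      have h6 : (1 - t ^ 2) * W * 1 ≤ (1 - t ^ 2) * W * (3 * t ^ 2 * (1 + t ^ 2)) := by gcongr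
      nlinarith [pow_pos ht0 2]
    rw [show 2 * (P / (3 * (W - 1))) * W = 2 * P * W / (3 * (W - 1)) by ring,
      div_le_div_iff₀ (by positivity) hs0]
    nlinarith
  have h4 : (P - 2 * (A * W) + 2 * R - B * W + Q) / (3 * (W - 1)) ≤ P / (3 * (W - 1)) := by
    gcongr
    linarith
  have h5 : 2 * ((P - 2 * (A * W) + 2 * R - B * W + Q) / (3 * (W - 1))) * W ≤
    2 * (P / (3 * (W - 1))) * W := by gcongr
  linarith

/-- Proposition 3.7: if `t ∈ (0,1)` and `γ₂(t) ≥ 0`, then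
`ι₂(t) = γ₂′(t) + 2 α₃(t) τ₁′(t) > 0`. -/
theorem iota2_positive (N : ℕ) (hN : 7 ≤ N) (t : ℝ) (ht0 : 0 < t) (ht1 : t < 1)
    (τ γ : ℝ → ℝ)
    (hτ : ∀ s : ℝ, τ s = 1 / s ^ (N - 2) - 1)
    (hγ : ∀ s : ℝ, γ s = 1 / (1 - s ^ 2) ^ (N - 2) - 2 / (Real.sqrt 2 * s) ^ (N - 2) +
        2 / (s ^ 4 + 1) ^ (((N : ℝ) - 2) / 2) - 1 / (2 * s) ^ (N - 2) +
        1 / (s ^ 2 + 1) ^ (N - 2))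
    (hγt : 0 ≤ γ t) :
    0 < deriv γ t +
        2 * ((-(3 * τ t) + Real.sqrt (9 * (τ t) ^ 2 + 4 * γ t)) / 2) * deriv τ t := by
  obtain ⟨n, rfl⟩ : ∃ n, N = n + 2 := ⟨N - 2, by omega⟩
  have hn : 5 ≤ n := by omega
  have hroot : ∀ s : ℝ, (s ^ 4 + 1) ^ ((((n + 2 : ℕ) : ℝ) - 2) / 2) = √(s ^ 4 + 1) ^ n := by
    intro s
    rw [Real.sqrt_eq_rpow, ← Real.rpow_natCast _ n, ← Real.rpow_mul (by positivity)]
    congr 1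
    push_cast
    ring
  simp only [hroot, Nat.add_sub_cancel] at hτ hγ
  have h2 : 0 < √2 := by positivity
  have hsq2 : √2 ^ 2 = 2 := Real.sq_sqrt (by norm_num)
  have hs0 : 0 < 1 - t ^ 2 := by nlinarith
  have hr : 0 < √(t ^ 4 + 1) := by positivity
  have hrr : √(t ^ 4 + 1) ^ 2 = t ^ 4 + 1 := Real.sq_sqrt (by positivity)
  have dτ : HasDerivAt τ _ t :=
    (((hasDerivAt_id t).const_div_pow 1 n ht0.ne').sub_const 1).congr_of_eventuallyEq
      (.of_forall hτ)
  have d4 : HasDerivAt (fun s : ℝ => √(s ^ 4 + 1)) _ t :=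
    (((hasDerivAt_id t).fun_pow 4).add_const 1).sqrt (by positivity)
  have dγ : HasDerivAt γ _ t :=
    ((((((((hasDerivAt_id t).fun_pow 2).const_sub 1).const_div_pow 1 n hs0.ne').sub
      (((hasDerivAt_id t).const_mul (√2)).const_div_pow 2 n (by positivity))).add
      (d4.const_div_pow 2 n hr.ne')).sub
      (((hasDerivAt_id t).const_mul 2).const_div_pow 1 n (by positivity))).add
      ((((hasDerivAt_id t).fun_pow 2).add_const 1).const_div_pow 1 n
        (by positivity))).congr_of_eventuallyEq (.of_forall hγ)
  have hγv : γ t = 1 / (1 - t ^ 2) ^ n - 2 * (1 / √2 ^ n * (1 / t ^ n)) +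
      2 * (1 / √(t ^ 4 + 1) ^ n) - 1 / 2 ^ n * (1 / t ^ n) + 1 / (t ^ 2 + 1) ^ n := by
    rw [hγ, mul_pow, mul_pow]; field_simp
  have hB := two_mul_one_div_two_pow_lt hn
  have hRA : 1 / √(t ^ 4 + 1) ^ n ≤ 1 / √2 ^ n * (1 / t ^ n) := by
    refine one_div_pow_le_mul_one_div_pow n h2 ht0 (abs_le_of_sq_le_sq' ?_ hr.le).2
    rw [mul_pow, hsq2, hrr]
    nlinarith [sq_nonneg (t ^ 2 - 1)]
  have hQB : 1 / (t ^ 2 + 1) ^ n ≤ 1 / 2 ^ n * (1 / t ^ n) :=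
    one_div_pow_le_mul_one_div_pow n two_pos ht0 (by nlinarith [sq_nonneg (t - 1)])
  have hW : 1 ≤ t ^ 4 * (1 / t ^ n) := by
    rw [mul_one_div, le_div_iff₀ (by positivity), one_mul]
    exact pow_le_pow_of_le_one ht0.le ht1.le (by omega)
  have hs : 1 + t ^ 4 < 4 * t ^ 2 := by
    by_contra! h
    have hPA : 1 / (1 - t ^ 2) ^ n ≤ 1 / √2 ^ n * (1 / t ^ n) := by
      refine one_div_pow_le_mul_one_div_pow n h2 ht0 (abs_le_of_sq_le_sq' ?_ hs0.le).2
      rw [mul_pow, hsq2]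
      nlinarith
    have hRB : 1 / √(t ^ 4 + 1) ^ n ≤ 1 / 2 ^ n * (1 / t ^ n) := by
      refine one_div_pow_le_mul_one_div_pow n two_pos ht0 (abs_le_of_sq_le_sq' ?_ hr.le).2
      rw [mul_pow, hrr]
      linarith
    have := mul_lt_mul_of_pos_right hB (show 0 < 1 / t ^ n by positivity)
    linarith
  have hτ0 : 0 < τ t := by
    rw [hτ, sub_pos]
    exact one_lt_one_div (by positivity) (pow_lt_one₀ ht0.le ht1 (by omega))
  have hα := half_neg_add_sqrt_le hτ0 hγt
  have key := rational_bound ht0 ht1 hW (by positivity) (by positivity) (by positivity)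
    hRA hQB hs (P := 1 / (1 - t ^ 2) ^ n)
  rw [← hγv, ← hτ] at key
  have hn0 : (0 : ℝ) < n := by positivity
  have eτ : deriv τ t = -(n / t * (1 / t ^ n)) := by
    rw [dτ.deriv]; simp only [id]; ring
  have eγ : deriv γ t = n / t * (2 * t ^ 2 * (1 / (1 - t ^ 2) ^ n) / (1 - t ^ 2) +
      2 * (1 / √2 ^ n * (1 / t ^ n)) - 4 * t ^ 4 * (1 / √(t ^ 4 + 1) ^ n) / (t ^ 4 + 1) +
      1 / 2 ^ n * (1 / t ^ n) - 2 * t ^ 2 * (1 / (t ^ 2 + 1) ^ n) / (t ^ 2 + 1)) := by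
    rw [dγ.deriv]
    simp only [id, mul_pow]
    have hr' := hr.ne'
    generalize √(t ^ 4 + 1) = r at hr' hrr
    rw [← hrr]
    have := hs0.ne'
    field_simp
    norm_num
    ring
  rw [eτ, eγ]
  have hc : 0 < n / t := by positivity
  have hα' : 2 * ((-(3 * τ t) + √(9 * τ t ^ 2 + 4 * γ t)) / 2) * (1 / t ^ n) ≤
      2 * (γ t / (3 * τ t)) * (1 / t ^ n) := by gcongr
  have := mul_pos hc (sub_pos.2 (hα'.trans_lt key))
  linarith
end

section
/- Let N ≥ 7 be an integer and let t be a real number with (√6 − √2)/2 < t < 1. Set T = t²/(1 − t²). Then (T^N + 3T)·(1 − t^{N−2})² > 1. -/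
/-- Lower bound for the left endpoint of the interval of admissible `t`. -/
lemma lt_half_sqrt_six_sub_sqrt_two :
    (0.5175 : ℝ) < (Real.sqrt 6 - Real.sqrt 2) / 2 := by
  have h6 : (2.4494 : ℝ) < Real.sqrt 6 := Real.lt_sqrt_of_sq_lt (by norm_num)
  have h2 : Real.sqrt 2 < 1.4143 := (Real.sqrt_lt' (by norm_num)).2 (by norm_num)
  linarith

lemma quartic_pos {s : ℝ} (h₀ : 0.2678 ≤ s) (h₁ : s ≤ 2 / 3) :
    0 < 4 * s - 1 - 5 * s ^ 4 - 9 / 5 * s ^ 3 := by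
  have h := mul_nonneg (sub_nonneg.2 h₀) (sub_nonneg.2 h₁)
  have hs : 0 ≤ s := by linarith
  nlinarith [mul_nonneg h hs, mul_nonneg h (sq_nonneg s)]

lemma one_sub_sq_lt_of_sq_le_two_thirds {t : ℝ} (h₀ : 0.5175 < t) (h₁ : t ^ 2 ≤ 2 / 3) :
    1 - t ^ 2 < 3 * t ^ 2 * (1 - t ^ 5) ^ 2 := by
  have hq := quartic_pos (s := t ^ 2) (by nlinarith) h₁
  have ht : t ≤ 5 / 6 * t ^ 2 + 3 / 10 := by nlinarith [sq_nonneg (t - 3 / 5)]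
  have h7 := mul_le_mul_of_nonneg_left ht (by positivity : 0 ≤ t ^ 6)
  have h12 : 0 ≤ t ^ 12 := by positivity
  nlinarith

/-- inequality (3.57): for `N ≥ 7` and `(√6 − √2)/2 < t < 1`,
with `T = t²/(1−t²)`, one has `(T^N + 3T)(1 − t^{N−2})² > 1`. -/
theorem key_inequality (N : ℕ) (hN : 7 ≤ N) (t : ℝ)
    (ht0 : (Real.sqrt 6 - Real.sqrt 2) / 2 < t) (ht1 : t < 1) :
    ((t ^ 2 / (1 - t ^ 2)) ^ N + 3 * (t ^ 2 / (1 - t ^ 2))) * (1 - t ^ (N - 2)) ^ 2 > 1 := by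
  have ha : 0.5175 < t := lt_half_sqrt_six_sub_sqrt_two.trans ht0
  have htpos : 0 < t := by linarith
  have hd : 0 < 1 - t ^ 2 := by nlinarith
  have hp : t ^ (N - 2) ≤ t ^ 5 := pow_le_pow_of_le_one htpos.le ht1.le (by omega)
  have h5 : t ^ 5 ≤ t := pow_le_of_le_one htpos.le ht1.le (by norm_num)
  set T := t ^ 2 / (1 - t ^ 2) with hT
  have hTpos : 0 < T := by positivity
  rcases le_total (t ^ 2) (2 / 3) with hs | hs
  · calc 1 < 3 * T * (1 - t ^ 5) ^ 2 := by
          rw [hT, mul_div_assoc', div_mul_eq_mul_div, lt_div_iff₀ hd, one_mul]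
          exact one_sub_sq_lt_of_sq_le_two_thirds ha hs
      _ ≤ (T ^ N + 3 * T) * (1 - t ^ (N - 2)) ^ 2 := by
          have hTN : 0 ≤ T ^ N := by positivity
          gcongr
          · linarith
          · linarith
  · have hT2 : 2 ≤ T := by
      rw [hT, le_div_iff₀ hd]
      linarith
    have hTN : T ^ 7 ≤ T ^ N := pow_le_pow_right₀ (by linarith) hN
    have hT7 : 32 * T ^ 2 ≤ T ^ 7 := by
      have h : (2 : ℝ) ^ 5 ≤ T ^ 5 := by gcongr
      nlinarith [mul_le_mul_of_nonneg_right h (sq_nonneg T)]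
    have hTt : 2 / 3 ≤ T * (1 - t ^ 2) := by
      rw [hT, div_mul_cancel₀ _ hd.ne']
      exact hs
    have hTt' : 1 / 3 ≤ T * (1 - t) := by
      nlinarith [mul_nonneg hTpos.le (sq_nonneg (1 - t))]
    calc 1 < 32 * (T * (1 - t)) ^ 2 := by nlinarith
      _ = 32 * T ^ 2 * (1 - t) ^ 2 := by ring
      _ ≤ (T ^ N + 3 * T) * (1 - t ^ (N - 2)) ^ 2 := by
          gcongr
          · linarith
          · linarith
end

section
/- Let N ≥ 7 be an integer and set t₀ = (√6 − √2)/2. Then γ₂(t₀) < 0, where γ₂(t) = 1/(1−t²)^{N−2} − 2/(√2·t)^{N−2} + 2/(t⁴+1)^{(N−2)/2} − 1/(2t)^{N−2} + 1/(t²+1)^{N−2}. (Consequently, the zero t* of γ₂ satisfies t* > (√6 − √2)/2.) -/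
/-- `γ₂((√6 − √2)/2) < 0` for every `N ≥ 7`. -/
theorem gamma2_negative_at_t0 (N : ℕ) (hN : 7 ≤ N)
    (γ : ℝ → ℝ)
    (hγ : ∀ t : ℝ, γ t = 1 / (1 - t ^ 2) ^ (N - 2) - 2 / (Real.sqrt 2 * t) ^ (N - 2) +
        2 / (t ^ 4 + 1) ^ (((N : ℝ) - 2) / 2) - 1 / (2 * t) ^ (N - 2) +
        1 / (t ^ 2 + 1) ^ (N - 2)) :
    γ ((Real.sqrt 6 - Real.sqrt 2) / 2) < 0 := by
  obtain ⟨m, rfl⟩ : ∃ m, N = m + 2 := ⟨N - 2, by omega⟩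
  have h6 : Real.sqrt 6 = Real.sqrt 2 * Real.sqrt 3 := by
    rw [← Real.sqrt_mul (by norm_num)]
    norm_num
  have h2 : Real.sqrt 2 ^ 2 = 2 := Real.sq_sqrt (by norm_num)
  have h3 : Real.sqrt 3 ^ 2 = 3 := Real.sq_sqrt (by norm_num)
  have p2 : 0 < Real.sqrt 2 := by positivity
  have p3 : 1 < Real.sqrt 3 := Real.lt_sqrt_of_sq_lt (by norm_num)
  rw [hγ, h6]
  generalize Real.sqrt 2 = a at *
  generalize Real.sqrt 3 = b at *
  have hu : 0 < b - 1 := by linarith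
  have hsq : ((a * b - a) / 2) ^ 2 = 2 - b := by
    linear_combination (b - 1) ^ 2 / 4 * h2 + h3 / 2
  have e1 : 1 - ((a * b - a) / 2) ^ 2 = b - 1 := by rw [hsq]; ring
  have e2 : a * ((a * b - a) / 2) = b - 1 := by linear_combination (b - 1) / 2 * h2
  have e3 : ((a * b - a) / 2) ^ 4 + 1 = (a * (b - 1)) ^ 2 := by
    linear_combination (((a * b - a) / 2) ^ 2 + 2 - b) * hsq - (b - 1) ^ 2 * h2 - h3
  have e4 : 2 * ((a * b - a) / 2) = a * (b - 1) := by ring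
  have e5 : ((a * b - a) / 2) ^ 2 + 1 = b * (b - 1) := by rw [hsq]; linear_combination -h3
  have e6 : ((a * (b - 1)) ^ 2) ^ ((((m + 2 : ℕ) : ℝ) - 2) / 2) = (a * (b - 1)) ^ m := by
    rw [← Real.rpow_natCast (a * (b - 1)) 2, ← Real.rpow_mul (by positivity),
      ← Real.rpow_natCast (a * (b - 1)) m]
    congr 1
    push_cast
    ring
  have pow_ge : ∀ x : ℝ, 0 < x → 2 ≤ x ^ 2 → x ^ 2 ≤ x ^ m := fun x hx h =>
    pow_le_pow_right₀ (by nlinarith) (by omega)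
  have ha : 1 / a ^ m ≤ 1 / 2 :=
    one_div_le_one_div_of_le (by norm_num) (h2 ▸ pow_ge a p2 h2.ge)
  have hb : 1 / b ^ m ≤ 1 / 3 :=
    one_div_le_one_div_of_le (by norm_num)
      (h3 ▸ pow_ge b (by linarith) (by rw [h3]; norm_num))
  rw [e1, e2, e3, e4, e5, e6, Nat.add_sub_cancel, mul_pow, mul_pow]
  have hb0 : b ≠ 0 := by linarith
  have key : 1 / (b - 1) ^ m - 2 / (b - 1) ^ m + 2 / (a ^ m * (b - 1) ^ m) -
      1 / (a ^ m * (b - 1) ^ m) + 1 / (b ^ m * (b - 1) ^ m) =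
      1 / (b - 1) ^ m * (1 / a ^ m + 1 / b ^ m - 1) := by
    field_simp
    ring
  rw [key]
  exact mul_neg_of_pos_of_neg (by positivity) (by linarith)
end

section
/- Let N ≥ 7 be an integer. The function γ₂(t) = 1/(1−t²)^{N−2} − 2/(√2·t)^{N−2} + 2/(t⁴+1)^{(N−2)/2} − 1/(2t)^{N−2} + 1/(t²+1)^{N−2} is strictly increasing on (0,1), tends to −∞ as t → 0⁺, and satisfies γ₂(1/√2) > 0. Consequently there exists a unique t* ∈ (0, 1/√2) with γ₂(t*) = 0, and γ₂(t) > 0 for every t ∈ (t*, 1). -/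
theorem one_add_pow_add_one_sub_pow_mono {x y : ℝ} (hx : 0 ≤ x) (hxy : x ≤ y) (n : ℕ) :
    0 ≤ (1 + x) ^ n + (1 - x) ^ n ∧ 0 ≤ (1 + x) ^ n - (1 - x) ^ n ∧
      (1 + x) ^ n + (1 - x) ^ n ≤ (1 + y) ^ n + (1 - y) ^ n ∧
      (1 + x) ^ n - (1 - x) ^ n ≤ (1 + y) ^ n - (1 - y) ^ n := by
  induction n with
  | zero => norm_num
  | succ n ih =>
    obtain ⟨hs, hd, hs', hd'⟩ := ih
    have e₁ (z : ℝ) : (1 + z) ^ (n + 1) + (1 - z) ^ (n + 1) =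
        ((1 + z) ^ n + (1 - z) ^ n) + z * ((1 + z) ^ n - (1 - z) ^ n) := by ring
    have e₂ (z : ℝ) : (1 + z) ^ (n + 1) - (1 - z) ^ (n + 1) =
        ((1 + z) ^ n - (1 - z) ^ n) + z * ((1 + z) ^ n + (1 - z) ^ n) := by ring
    have hy : 0 ≤ y := hx.trans hxy
    simp only [e₁, e₂]
    refine ⟨by positivity, by positivity, by gcongr, by gcongr⟩

theorem inv_one_sub_pow_add_inv_one_add_pow_mono {x y : ℝ} (hx : 0 ≤ x) (hxy : x ≤ y)
    (hy : y < 1) (n : ℕ) :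
    1 / (1 - x) ^ n + 1 / (x + 1) ^ n ≤ 1 / (1 - y) ^ n + 1 / (y + 1) ^ n := by
  obtain ⟨hs, -, hs', -⟩ := one_add_pow_add_one_sub_pow_mono hx hxy n
  have key (z : ℝ) (h0 : 0 ≤ z) (h1 : z < 1) :
      1 / (1 - z) ^ n + 1 / (z + 1) ^ n = ((1 + z) ^ n + (1 - z) ^ n) / (1 - z ^ 2) ^ n := by
    have h₁ : (1 - z) ^ n ≠ 0 := pow_ne_zero _ (by linarith)
    have h₂ : (1 + z) ^ n ≠ 0 := pow_ne_zero _ (by linarith)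
    rw [show 1 - z ^ 2 = (1 - z) * (1 + z) by ring, mul_pow, add_comm z 1]
    field_simp
  rw [key x hx (by linarith), key y (by linarith) hy]
  have : 0 < 1 - y ^ 2 := by nlinarith
  gcongr
  exact hs.trans hs'

theorem sqrt_two_mul_pow_eq_rpow {t : ℝ} (ht : 0 ≤ t) (n : ℕ) :
    (√2 * t) ^ n = (2 * t ^ 2) ^ ((n : ℝ) / 2) := by
  have h : 2 * t ^ 2 = (√2 * t) ^ (2 : ℝ) := by
    rw [Real.rpow_two, mul_pow, Real.sq_sqrt (by norm_num)]
  rw [h, ← Real.rpow_mul (by positivity), mul_div_cancel₀ _ (by norm_num), Real.rpow_natCast]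

theorem inv_rpow_sub_inv_rpow_antitone {x y r : ℝ} (hx : 0 < x) (hxy : x ≤ y) (hy : y ≤ 1)
    (hr : 0 ≤ r) :
    1 / (2 * y) ^ r - 1 / (y ^ 2 + 1) ^ r ≤ 1 / (2 * x) ^ r - 1 / (x ^ 2 + 1) ^ r := by
  have key (z : ℝ) (hz : 0 < z) : 1 / (2 * z) ^ r - 1 / (z ^ 2 + 1) ^ r =
      1 / (2 * z) ^ r * (1 - (2 * z / (z ^ 2 + 1)) ^ r) := by
    rw [Real.div_rpow (by positivity) (by positivity)]
    field_simp
  have hy0 : 0 < y := hx.trans_le hxy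
  rw [key x hx, key y hy0]
  have hmono : 2 * x / (x ^ 2 + 1) ≤ 2 * y / (y ^ 2 + 1) := by
    rw [div_le_div_iff₀ (by positivity) (by positivity)]
    nlinarith [mul_nonneg (sub_nonneg.2 hxy) (show 0 ≤ 1 - x * y by nlinarith)]
  have hle : (2 * y / (y ^ 2 + 1)) ^ r ≤ 1 := by
    apply Real.rpow_le_one (by positivity) _ hr
    rw [div_le_one (by positivity)]
    nlinarith [sq_nonneg (y - 1)]
  have hnonneg : 0 ≤ 1 - (2 * y / (y ^ 2 + 1)) ^ r := by linarith
  gcongr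

/-- formula (3.56): properties of `γ₂` on `(0,1)`: strictly increasing,
`→ −∞` as `t → 0⁺`, positive at `1/√2`, hence a unique zero `t* ∈ (0, 1/√2)` with
`γ₂ > 0` on `(t*, 1)`. -/
theorem gamma2_properties (N : ℕ) (hN : 7 ≤ N)
    (γ : ℝ → ℝ)
    (hγ : ∀ t : ℝ, γ t = 1 / (1 - t ^ 2) ^ (N - 2) - 2 / (Real.sqrt 2 * t) ^ (N - 2) +
        2 / (t ^ 4 + 1) ^ (((N : ℝ) - 2) / 2) - 1 / (2 * t) ^ (N - 2) +
        1 / (t ^ 2 + 1) ^ (N - 2)) :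
    StrictMonoOn γ (Set.Ioo 0 1) ∧
    Filter.Tendsto γ (nhdsWithin 0 (Set.Ioi 0)) Filter.atBot ∧
    0 < γ (1 / Real.sqrt 2) ∧
    ∃ tstar ∈ Set.Ioo (0 : ℝ) (1 / Real.sqrt 2), γ tstar = 0 ∧
      (∀ s ∈ Set.Ioo (0 : ℝ) (1 / Real.sqrt 2), γ s = 0 → s = tstar) ∧
      ∀ t ∈ Set.Ioo tstar 1, 0 < γ t := by
  obtain ⟨n, rfl⟩ : ∃ n, N = n + 2 := ⟨N - 2, by omega⟩
  have hn : 5 ≤ n := by omega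
  have hn0 : n ≠ 0 := by omega
  simp only [Nat.add_sub_cancel, Nat.cast_add, Nat.cast_ofNat, add_sub_cancel_right] at hγ
  have hr : (0 : ℝ) ≤ (n : ℝ) / 2 := by positivity
  have hmono : StrictMonoOn γ (Set.Ioo 0 1) := by
    rintro x ⟨hx0, hx1⟩ y ⟨hy0, hy1⟩ hxy
    have hsq : x ^ 2 ≤ y ^ 2 := by gcongr
    have hy2 : y ^ 2 < 1 := by nlinarith
    have h₁ := inv_one_sub_pow_add_inv_one_add_pow_mono (sq_nonneg x) hsq hy2 n
    have h₂ := inv_rpow_sub_inv_rpow_antitone (by positivity) hsq hy2.le hr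
    have h₃ : 1 / (2 * y) ^ n < 1 / (2 * x) ^ n := by gcongr
    rw [← sqrt_two_mul_pow_eq_rpow hx0.le, ← sqrt_two_mul_pow_eq_rpow hy0.le,
      ← pow_mul, ← pow_mul] at h₂
    have e (a : ℝ) : 2 / a = 2 * (1 / a) := by ring
    rw [hγ, hγ]
    simp only [e] at *
    linarith
  have hlim : Filter.Tendsto γ (nhdsWithin 0 (Set.Ioi 0)) Filter.atBot := by
    have hpole (c : ℝ) (hc : 0 < c) :
        Filter.Tendsto (fun t : ℝ => -(1 / (c * t) ^ n)) (nhdsWithin 0 (Set.Ioi 0))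
          Filter.atBot := by
      refine Filter.tendsto_neg_atTop_atBot.comp ?_
      simp only [one_div]
      refine Filter.Tendsto.comp tendsto_inv_nhdsGT_zero ?_
      refine tendsto_nhdsWithin_iff.2 ⟨?_, ?_⟩
      · have : Continuous fun t : ℝ => (c * t) ^ n := by fun_prop
        have := this.tendsto 0
        simp only [mul_zero, zero_pow hn0] at this
        exact this.mono_left nhdsWithin_le_nhds
      · filter_upwards [self_mem_nhdsWithin] with t ht
        have : 0 < t := ht
        exact Set.mem_Ioi.2 (by positivity)
    have hreg : ContinuousAt (fun t : ℝ => 1 / (1 - t ^ 2) ^ n +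
        2 / (t ^ 4 + 1) ^ ((n : ℝ) / 2) + 1 / (t ^ 2 + 1) ^ n) 0 := by
      refine ContinuousAt.add (ContinuousAt.add ?_ ?_) ?_
      · exact ContinuousAt.div₀ (by fun_prop) (by fun_prop) (by norm_num)
      · refine ContinuousAt.div₀ (by fun_prop) ?_ (by norm_num)
        exact ContinuousAt.rpow_const (by fun_prop) (Or.inr hr)
      · exact ContinuousAt.div₀ (by fun_prop) (by fun_prop) (by norm_num)
    have h := (((hreg.tendsto.mono_left nhdsWithin_le_nhds).add_atBot
      (hpole √2 (by positivity))).atBot_add_atBot (hpole √2 (by positivity))).atBot_add_atBot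
      (hpole 2 two_pos)
    refine h.congr fun t => ?_
    rw [hγ]
    ring
  have hs0 : 0 < 1 / √2 := by positivity
  have hs2 : (1 / √2) ^ 2 = 1 / 2 := by rw [div_pow, Real.sq_sqrt (by norm_num)]; norm_num
  have hs1 : 1 / √2 < 1 := by nlinarith
  have hpos : 0 < γ (1 / √2) := by
    rw [hγ, hs2, mul_one_div_cancel (by positivity)]
    have h₁ : (4 : ℝ) ≤ 1 / (1 - 1 / 2) ^ n := by
      rw [show (1 : ℝ) - 1 / 2 = 2⁻¹ by norm_num, inv_pow, one_div, inv_inv]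
      calc (4 : ℝ) = 2 ^ 2 := by norm_num
        _ ≤ 2 ^ n := pow_le_pow_right₀ (by norm_num) (by omega)
    have h₂ : 1 / (2 * (1 / √2)) ^ n ≤ 1 := by
      refine div_le_one_of_le₀ (one_le_pow₀ ?_) (by positivity)
      nlinarith
    have h₃ : 0 < 2 / ((1 / √2) ^ 4 + 1) ^ ((n : ℝ) / 2) := by positivity
    have h₄ : (0 : ℝ) < 1 / (1 / 2 + 1) ^ n := by positivity
    simp only [one_pow]
    linarith
  refine ⟨hmono, hlim, hpos, ?_⟩
  obtain ⟨a, ha, ha0, ha1⟩ : ∃ a, γ a < 0 ∧ 0 < a ∧ a < 1 / √2 :=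
    ((hlim.eventually_lt_atBot 0).and (Ioo_mem_nhdsGT hs0)).exists
  have hcont : ContinuousOn γ (Set.Icc a (1 / √2)) := by
    rw [show γ = _ from funext hγ]
    intro t ht
    have ht0 : 0 < t := ha0.trans_le ht.1
    have ht1 : 0 < 1 - t ^ 2 := by nlinarith [ht.2]
    refine ContinuousAt.continuousWithinAt ?_
    refine ContinuousAt.add (ContinuousAt.sub (ContinuousAt.add (ContinuousAt.sub ?_ ?_) ?_) ?_) ?_
    · exact ContinuousAt.div₀ (by fun_prop) (by fun_prop) (by positivity)
    · exact ContinuousAt.div₀ (by fun_prop) (by fun_prop) (by positivity)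
    · refine ContinuousAt.div₀ (by fun_prop) ?_ (by positivity)
      exact ContinuousAt.rpow_const (by fun_prop) (Or.inr hr)
    · exact ContinuousAt.div₀ (by fun_prop) (by fun_prop) (by positivity)
    · exact ContinuousAt.div₀ (by fun_prop) (by fun_prop) (by positivity)
  obtain ⟨c, ⟨hac, hcs⟩, hc⟩ := intermediate_value_Ioo ha1.le hcont ⟨ha, hpos⟩
  have hc0 : 0 < c := ha0.trans hac
  refine ⟨c, ⟨hc0, hcs⟩, hc, fun s hs h => ?_, fun t ht => ?_⟩
  · exact hmono.injOn ⟨hs.1, hs.2.trans hs1⟩ ⟨hc0, hcs.trans hs1⟩ (h.trans hc.symm)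
  · exact hc ▸ hmono ⟨hc0, hcs.trans hs1⟩ ⟨hc0.trans ht.1, ht.2⟩ ht.1
end

section
/- Let N ≥ 7 be an integer. The function γ₁(t) = 1/(1−t²)^{N−2} − 2/(√3·t)^{N−2} + 2/(t⁴+t²+1)^{(N−2)/2} is strictly increasing on (0,1), tends to −∞ as t → 0⁺, and satisfies γ₁(1/2) > 0. Consequently there exists a unique t* ∈ (0, 1/2) with γ₁(t*) = 0, and γ₁(t) > 0 for every t ∈ (t*, 1). -/
open Set Filter Topology

/-- If `a < c` and `a / b ≤ c / d < 1`, then `1 / a ^ n - 1 / b ^ n` exceeds `1 / c ^ n - 1 / d ^ n`. -/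
theorem inv_pow_sub_inv_pow_lt {a b c d : ℝ} {n : ℕ} (hn : n ≠ 0) (ha : 0 < a) (hac : a < c)
    (hb : 0 < b) (hcd : c < d) (h : a / b ≤ c / d) :
    1 / c ^ n - 1 / d ^ n < 1 / a ^ n - 1 / b ^ n := by
  have hc : 0 < c := ha.trans hac
  have hd : 0 < d := hc.trans hcd
  have key : ∀ {u v : ℝ}, 0 < u → 0 < v →
      1 / u ^ n - 1 / v ^ n = 1 / u ^ n * (1 - (u / v) ^ n) := by
    intro u v hu hv
    rw [div_pow]
    field_simp
  rw [key hc hd, key ha hb]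
  have h1 : (c / d) ^ n < 1 := pow_lt_one₀ (by positivity) ((div_lt_one hd).2 hcd) hn
  have h2 : (a / b) ^ n ≤ (c / d) ^ n := pow_le_pow_left₀ (by positivity) h n
  have h3 : 1 / c ^ n < 1 / a ^ n :=
    one_div_lt_one_div_of_lt (by positivity) (pow_lt_pow_left₀ hac ha.le hn)
  exact mul_lt_mul h3 (by linarith) (by linarith) (by positivity)

theorem sqrt_three_mul_lt_sqrt {t : ℝ} (ht : t ∈ Ioo (0 : ℝ) 1) :
    √3 * t < √(t ^ 4 + t ^ 2 + 1) := by
  obtain ⟨h0, h1⟩ := ht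
  have h2 : t ^ 2 < 1 := by nlinarith
  apply Real.lt_sqrt_of_sq_lt
  rw [mul_pow, Real.sq_sqrt (by norm_num)]
  nlinarith [mul_pos (sub_pos.2 h2) (sub_pos.2 h2)]

theorem monotoneOn_sqrt_three_mul_div_sqrt :
    MonotoneOn (fun t : ℝ => √3 * t / √(t ^ 4 + t ^ 2 + 1)) (Ioo 0 1) := by
  rintro x ⟨hx0, hx1⟩ y ⟨hy0, hy1⟩ hxy
  have hx : 0 < x ^ 4 + x ^ 2 + 1 := by positivity
  have hy : 0 < y ^ 4 + y ^ 2 + 1 := by positivity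
  have h1 : x ^ 2 ≤ y ^ 2 := pow_le_pow_left₀ hx0.le hxy 2
  have h2 : x ^ 2 * y ^ 2 ≤ 1 := mul_le_one₀ (by nlinarith) (by positivity) (by nlinarith)
  refine (sq_le_sq₀ (by positivity) (by positivity)).1 ?_
  rw [div_pow, div_pow, mul_pow, mul_pow, Real.sq_sqrt hx.le, Real.sq_sqrt hy.le,
    Real.sq_sqrt (by norm_num), div_le_div_iff₀ hx hy]
  nlinarith [mul_nonneg (sub_nonneg.2 h1) (sub_nonneg.2 h2)]

/-- formula (3.53): properties of `γ₁` on `(0,1)`: strictly increasing,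
`→ −∞` as `t → 0⁺`, positive at `1/2`, hence a unique zero `t* ∈ (0, 1/2)` with
`γ₁ > 0` on `(t*, 1)`. -/
theorem gamma1_properties (N : ℕ) (hN : 7 ≤ N)
    (γ : ℝ → ℝ)
    (hγ : ∀ t : ℝ, γ t = 1 / (1 - t ^ 2) ^ (N - 2) - 2 / (Real.sqrt 3 * t) ^ (N - 2) +
        2 / (t ^ 4 + t ^ 2 + 1) ^ (((N : ℝ) - 2) / 2)) :
    StrictMonoOn γ (Set.Ioo 0 1) ∧
    Filter.Tendsto γ (nhdsWithin 0 (Set.Ioi 0)) Filter.atBot ∧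
    0 < γ (1 / 2) ∧
    ∃ tstar ∈ Set.Ioo (0 : ℝ) (1 / 2), γ tstar = 0 ∧
      (∀ s ∈ Set.Ioo (0 : ℝ) (1 / 2), γ s = 0 → s = tstar) ∧
      ∀ t ∈ Set.Ioo tstar 1, 0 < γ t := by
  obtain ⟨n, rfl⟩ : ∃ n, N = n + 2 := ⟨N - 2, by omega⟩
  have hn : 5 ≤ n := by omega
  have hn0 : n ≠ 0 := by omega
  have hγ' : ∀ t : ℝ, γ t = 1 / (1 - t ^ 2) ^ n - 2 / (√3 * t) ^ n +
      2 / √(t ^ 4 + t ^ 2 + 1) ^ n := by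
    intro t
    rw [hγ, Nat.add_sub_cancel, Nat.cast_add, Nat.cast_ofNat, add_sub_cancel_right,
      Real.rpow_div_two_eq_sqrt _ (by positivity), Real.rpow_natCast]
  clear hγ
  have hmono : StrictMonoOn γ (Ioo 0 1) := by
    intro x hx y hy hxy
    have h1 := inv_pow_sub_inv_pow_lt (n := n) hn0 (mul_pos (by positivity) hx.1)
      (mul_lt_mul_of_pos_left hxy (by positivity : 0 < √3))
      (Real.sqrt_pos.2 (by positivity : 0 < x ^ 4 + x ^ 2 + 1)) (sqrt_three_mul_lt_sqrt hy)
      (monotoneOn_sqrt_three_mul_div_sqrt hx hy hxy.le)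
    have hy2 : 0 < 1 - y ^ 2 := by nlinarith [hy.1, hy.2]
    have hxy2 : 1 - y ^ 2 ≤ 1 - x ^ 2 := by nlinarith [hx.1]
    have h2 : 1 / (1 - x ^ 2) ^ n ≤ 1 / (1 - y ^ 2) ^ n :=
      one_div_le_one_div_of_le (by positivity) (pow_le_pow_left₀ hy2.le hxy2 n)
    have h3 : ∀ u : ℝ, 2 / u = 2 * (1 / u) := fun u => by ring
    rw [hγ', hγ', h3, h3, h3, h3]
    linarith
  have hlim : Tendsto γ (𝓝[>] 0) atBot := by
    have hs : ∀ t : ℝ, √(t ^ 4 + t ^ 2 + 1) ^ n ≠ 0 := fun t => by positivity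
    have hreg : Tendsto (fun t : ℝ => 1 / (1 - t ^ 2) ^ n + 2 / √(t ^ 4 + t ^ 2 + 1) ^ n)
        (𝓝[>] 0) (𝓝 (1 / (1 - 0 ^ 2) ^ n + 2 / √(0 ^ 4 + 0 ^ 2 + 1) ^ n)) := by
      apply tendsto_nhdsWithin_of_tendsto_nhds
      have : ContinuousAt
          (fun t : ℝ => 1 / (1 - t ^ 2) ^ n + 2 / √(t ^ 4 + t ^ 2 + 1) ^ n) 0 :=
        (ContinuousAt.div (by fun_prop) (by fun_prop) (by simp)).add
          (ContinuousAt.div (by fun_prop) (by fun_prop) (hs 0))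
      exact this
    have hpow : Tendsto (fun t : ℝ => (√3 * t) ^ n) (𝓝[>] 0) (𝓝[>] 0) := by
      refine tendsto_nhdsWithin_iff.2 ⟨?_, ?_⟩
      · apply tendsto_nhdsWithin_of_tendsto_nhds
        have : Continuous (fun t : ℝ => (√3 * t) ^ n) := by fun_prop
        simpa [hn0] using this.tendsto 0
      · filter_upwards [self_mem_nhdsWithin] with t ht
        have ht : 0 < t := ht
        exact mem_Ioi.2 (by positivity)
    have hsing : Tendsto (fun t : ℝ => -(2 * ((√3 * t) ^ n)⁻¹)) (𝓝[>] 0) atBot :=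
      tendsto_neg_atTop_atBot.comp
        ((tendsto_inv_nhdsGT_zero.comp hpow).const_mul_atTop (by norm_num))
    refine (hreg.add_atBot hsing).congr fun t => ?_
    rw [hγ']
    ring
  have hhalf : 0 < γ (1 / 2) := by
    set x : ℝ := (2 / √3) ^ n with hx
    have hx0 : 0 < x := by positivity
    have hsq : x ^ 2 = (4 / 3) ^ n := by
      rw [hx, pow_right_comm, div_pow, Real.sq_sqrt (by norm_num)]
      norm_num
    have hx4 : 4 < x ^ 2 := by
      rw [hsq]
      calc (4 : ℝ) < (4 / 3) ^ 5 := by norm_num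
        _ ≤ (4 / 3) ^ n := pow_le_pow_right₀ (by norm_num) hn
    have hx2 : 2 < x := by nlinarith
    have h1 : 1 / (1 - (1 / 2 : ℝ) ^ 2) ^ n = x ^ 2 := by
      rw [hsq, ← one_div_pow]
      norm_num
    have h2 : 2 / (√3 * (1 / 2)) ^ n = 2 * x := by
      rw [hx, div_eq_mul_inv, ← inv_pow]
      congr 2
      field_simp
    have h3 : 0 < 2 / √((1 / 2 : ℝ) ^ 4 + (1 / 2) ^ 2 + 1) ^ n := by positivity
    rw [hγ', h1, h2]
    nlinarith
  refine ⟨hmono, hlim, hhalf, ?_⟩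
  obtain ⟨a, haneg, ha0, ha⟩ : ∃ a, γ a < 0 ∧ a ∈ Ioo (0 : ℝ) (1 / 2) :=
    ((hlim.eventually (eventually_lt_atBot 0)).and
      (Ioo_mem_nhdsGT (by norm_num : (0 : ℝ) < 1 / 2))).exists
  have hcont : ContinuousOn γ (Icc a (1 / 2)) := by
    rw [funext hγ']
    have hne : ∀ t ∈ Icc a (1 / 2), (1 - t ^ 2) ^ n ≠ 0 ∧ (√3 * t) ^ n ≠ 0 := by
      rintro t ⟨h1, h2⟩
      have ht : 0 < t := ha0.trans_le h1
      have ht' : 0 < 1 - t ^ 2 := by nlinarith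
      exact ⟨by positivity, by positivity⟩
    refine ((ContinuousOn.div (by fun_prop) (by fun_prop) fun t ht => (hne t ht).1).sub
      (ContinuousOn.div (by fun_prop) (by fun_prop) fun t ht => (hne t ht).2)).add
      (ContinuousOn.div (by fun_prop) (by fun_prop) fun t _ => by positivity)
  obtain ⟨t, ⟨hat, ht⟩, hzero⟩ := intermediate_value_Ioo ha.le hcont ⟨haneg, hhalf⟩
  have ht0 : 0 < t := ha0.trans hat
  have htmem : t ∈ Ioo (0 : ℝ) 1 := ⟨ht0, by linarith⟩
  refine ⟨t, ⟨ht0, ht⟩, hzero, fun s hs hs0 => ?_, fun s hs => ?_⟩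
  · exact hmono.injOn ⟨hs.1, by linarith [hs.2]⟩ htmem (hs0.trans hzero.symm)
  · exact hzero ▸ hmono htmem ⟨ht0.trans hs.1, hs.2⟩ hs.1
end

section
/- There exists an integer N₀ ≥ 7 such that for every integer N ≥ N₀ the following inequality holds at t = 1/2: γ₁′(1/2) + 2 α₂(1/2) τ₁′(1/2) < 0, where γ₁′ and τ₁′ denote the derivatives of γ₁ and τ₁, and α₂(t) = −τ₁(t) + √(τ₁(t)² + γ₁(t)). -/
/-- A first-order lower bound for the larger root of `x ^ 2 + 2 * (P - 1) * x - g`. -/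
lemma le_neg_add_sqrt_of_le {P g : ℝ} (hP : 1 ≤ P) (hg : 0 ≤ g) (hgP : g ≤ 4 * P) :
    g / (2 * P) ≤ -(P - 1) + Real.sqrt ((P - 1) ^ 2 + g) := by
  have hP0 : 0 < P := by linarith
  suffices h : P - 1 + g / (2 * P) ≤ Real.sqrt ((P - 1) ^ 2 + g) by linarith
  apply Real.le_sqrt_of_sq_le
  have key : (P - 1) ^ 2 + g - (P - 1 + g / (2 * P)) ^ 2 = g * (4 * P - g) / (4 * P ^ 2) := by
    field_simp
    ring
  have : 0 ≤ g * (4 * P - g) / (4 * P ^ 2) :=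
    div_nonneg (mul_nonneg hg (by linarith)) (by positivity)
  linarith

lemma hasDerivAt_one_div_pow_half (k : ℕ) :
    HasDerivAt (fun t : ℝ => 1 / t ^ k) (-(2 * (k : ℝ) * 2 ^ k)) (1 / 2) := by
  have h := (hasDerivAt_const (1 / 2 : ℝ) (1 : ℝ)).div (hasDerivAt_pow k (1 / 2 : ℝ))
    (by positivity)
  refine h.congr_deriv ?_
  rcases k with _ | k
  · simp
  · simp only [Nat.add_sub_cancel, one_div, inv_pow]
    field_simp
    ring

lemma hasDerivAt_one_div_one_sub_sq_pow_half (k : ℕ) :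
    HasDerivAt (fun t : ℝ => 1 / (1 - t ^ 2) ^ k) ((k : ℝ) * (4 / 3 * (4 / 3) ^ k)) (1 / 2) := by
  have h := (hasDerivAt_const (1 / 2 : ℝ) (1 : ℝ)).div
    (((hasDerivAt_pow 2 (1 / 2 : ℝ)).const_sub (1 : ℝ)).pow k)
    (by norm_num)
  refine h.congr_deriv ?_
  have e : (1 - (1 / 2 : ℝ) ^ 2) = 3 / 4 := by norm_num
  have e' : (4 / 3 : ℝ) = (3 / 4)⁻¹ := by norm_num
  rcases k with _ | k
  · simp
  · simp only [Pi.pow_apply, e, e', inv_pow, Nat.add_sub_cancel]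
    field_simp
    norm_num
    ring

lemma exists_hasDerivAt_two_div_rpow_half {p : ℝ} (hp : 0 ≤ p) :
    ∃ d ≤ 0, HasDerivAt (fun t : ℝ => 2 / (t ^ 4 + t ^ 2 + 1) ^ p) d (1 / 2) := by
  have h := (hasDerivAt_const (1 / 2 : ℝ) (2 : ℝ)).div
    ((((hasDerivAt_pow 4 (1 / 2 : ℝ)).add (hasDerivAt_pow 2 (1 / 2 : ℝ))).add_const 1).rpow_const
      (p := p) (Or.inl (by norm_num)))
    (by simp only [Pi.add_apply]; positivity)
  refine ⟨_, ?_, h⟩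
  apply div_nonpos_of_nonpos_of_nonneg
  · simp only [Pi.add_apply, zero_mul, zero_sub, neg_nonpos]
    positivity
  · positivity

/-- for `N` large, `ι₁(1/2) = γ₁′(1/2) + 2 α₂(1/2) τ₁′(1/2) < 0`,
where `α₂(t) = −τ₁(t) + √(τ₁(t)² + γ₁(t))`. -/
theorem iota1_negative_for_large_N :
    ∃ N₀ : ℕ, 7 ≤ N₀ ∧ ∀ N : ℕ, N₀ ≤ N →
      ∀ τ γ : ℝ → ℝ,
        (∀ t : ℝ, τ t = 1 / t ^ (N - 2) - 1) →
        (∀ t : ℝ, γ t = 1 / (1 - t ^ 2) ^ (N - 2) - 2 / (Real.sqrt 3 * t) ^ (N - 2) +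
            2 / (t ^ 4 + t ^ 2 + 1) ^ (((N : ℝ) - 2) / 2)) →
        deriv γ (1 / 2) +
            2 * (-τ (1 / 2) + Real.sqrt ((τ (1 / 2)) ^ 2 + γ (1 / 2))) * deriv τ (1 / 2) < 0 := by
  refine ⟨20, by norm_num, fun N hN τ γ hτ hγ => ?_⟩
  obtain ⟨k, rfl⟩ : ∃ k, N = k + 2 := ⟨N - 2, by omega⟩
  have hk : 18 ≤ k := by omega
  have hk0 : (0 : ℝ) < k := by exact_mod_cast (by omega : 0 < k)
  have hp : (((k + 2 : ℕ) : ℝ) - 2) / 2 = k / 2 := by push_cast; ring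
  simp only [Nat.add_sub_cancel, hp] at hτ hγ
  set b : ℝ := 2 ^ k / Real.sqrt 3 ^ k with hb
  set c : ℝ := 2 / ((1 / 2 : ℝ) ^ 4 + (1 / 2) ^ 2 + 1) ^ ((k : ℝ) / 2) with hc
  have hb0 : 0 < b := by positivity
  have hb2 : b ^ 2 = (4 / 3) ^ k := by
    rw [hb, ← div_pow, ← pow_mul, mul_comm, pow_mul, div_pow, Real.sq_sqrt (by norm_num)]
    norm_num
  have hb12 : 12 < b := by
    have h : (4 / 3 : ℝ) ^ 18 ≤ (4 / 3) ^ k := pow_le_pow_right₀ (by norm_num) hk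
    have h' : (144 : ℝ) < (4 / 3) ^ 18 := by norm_num
    nlinarith
  have hP : (4 / 3 : ℝ) ^ k ≤ 2 ^ k := pow_le_pow_left₀ (by norm_num) (by norm_num) k
  have hc0 : 0 < c := by positivity
  have hc2 : c ≤ 2 :=
    div_le_self (by norm_num) (Real.one_le_rpow (by norm_num) (by positivity))
  have hτ' : HasDerivAt τ (-(2 * (k : ℝ) * 2 ^ k)) (1 / 2) := by
    rw [funext hτ]
    exact (hasDerivAt_one_div_pow_half k).sub_const 1
  obtain ⟨d, hd, hd'⟩ := exists_hasDerivAt_two_div_rpow_half (p := (k : ℝ) / 2) (by positivity)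
  have hγ' : HasDerivAt γ ((k : ℝ) * (4 / 3 * b ^ 2) + 4 * k * b + d) (1 / 2) := by
    have h := HasDerivAt.add ((hasDerivAt_one_div_one_sub_sq_pow_half k).sub
      ((hasDerivAt_one_div_pow_half k).const_mul (2 / Real.sqrt 3 ^ k))) hd'
    refine (h.congr_deriv ?_).congr_of_eventuallyEq (Filter.Eventually.of_forall fun t => ?_)
    · rw [hb2, hb]
      ring
    · simp only [hγ, Pi.add_apply, Pi.sub_apply, mul_pow]
      ring
  have hτv : τ (1 / 2) = 2 ^ k - 1 := by
    rw [hτ]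
    simp
  have hγv : γ (1 / 2) = b ^ 2 - 2 * b + c := by
    rw [hγ, hb2, ← hc, hb, mul_pow]
    have e : (1 - (1 / 2 : ℝ) ^ 2) = (4 / 3)⁻¹ := by norm_num
    rw [e, inv_pow, one_div, inv_inv, one_div, inv_pow]
    field_simp
  rw [hγ'.deriv, hτ'.deriv, hτv, hγv]
  have hα := le_neg_add_sqrt_of_le (P := 2 ^ k) (g := b ^ 2 - 2 * b + c)
    (one_le_pow₀ (by norm_num)) (by nlinarith) (by nlinarith)
  set α := -((2 : ℝ) ^ k - 1) + Real.sqrt ((2 ^ k - 1) ^ 2 + (b ^ 2 - 2 * b + c))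
  rw [div_le_iff₀ (by positivity)] at hα
  have hlt : 4 / 3 * b ^ 2 + 4 * b - 2 * (α * (2 * 2 ^ k)) < 0 := by nlinarith
  nlinarith [mul_neg_of_pos_of_neg hk0 hlt]
end

section
/- Let N ≥ 7 be an integer. The function γ₃(t) = 1/(1−t²)^{N−2} − 1/(2t)^{N−2} + 1/(t²+1)^{N−2} is strictly increasing on (0,1), tends to −∞ as t → 0⁺, tends to +∞ as t → 1⁻, and satisfies γ₃(1/2) > 0. Consequently there exists a unique t₁* ∈ (0, 1/2) with γ₃(t₁*) = 0, γ₃(t) < 0 for all t ∈ (0, t₁*), and γ₃(t) > 0 for all t ∈ (t₁*, 1). -/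
/-- If `v₂ ≤ v₁ ≤ u₁ ≤ u₂` and `[u₁, u₂]` is at least as long as `[v₂, v₁]`, then the same comparison
of lengths holds after raising the endpoints to a power. -/
lemma pow_sub_pow_le_pow_sub_pow {u₁ u₂ v₁ v₂ : ℝ} (h₀ : 0 ≤ v₂) (h₁ : v₂ ≤ v₁) (h₂ : v₁ ≤ u₁)
    (h₃ : u₁ ≤ u₂) (h : v₁ - v₂ ≤ u₂ - u₁) (m : ℕ) :
    v₁ ^ m - v₂ ^ m ≤ u₂ ^ m - u₁ ^ m := by
  induction m with
  | zero => simp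
  | succ m ih =>
    have hv : 0 ≤ v₁ ^ m - v₂ ^ m := sub_nonneg.2 (pow_le_pow_left₀ h₀ h₁ m)
    have hpow : v₂ ^ m ≤ u₁ ^ m := pow_le_pow_left₀ h₀ (h₁.trans h₂) m
    calc v₁ ^ (m + 1) - v₂ ^ (m + 1) = v₁ * (v₁ ^ m - v₂ ^ m) + v₂ ^ m * (v₁ - v₂) := by ring
      _ ≤ u₂ * (u₂ ^ m - u₁ ^ m) + u₁ ^ m * (u₂ - u₁) :=
        add_le_add
          (mul_le_mul (h₂.trans h₃) ih hv (by linarith))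
          (mul_le_mul hpow h (sub_nonneg.2 h₁) (pow_nonneg (by linarith) m))
      _ = u₂ ^ (m + 1) - u₁ ^ (m + 1) := by ring

/-- The function `x ↦ (1 - x)⁻ᵐ + (1 + x)⁻ᵐ` is monotone on `[0, 1)`. -/
lemma monotoneOn_inv_one_sub_pow_add_inv_one_add_pow (m : ℕ) :
    MonotoneOn (fun x : ℝ => ((1 - x) ^ m)⁻¹ + ((x + 1) ^ m)⁻¹) (Set.Ico 0 1) := by
  rintro x ⟨hx0, hx1⟩ y ⟨hy0, hy1⟩ hxy
  have hx : 0 < 1 - x := by linarith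
  have hy : 0 < 1 - y := by linarith
  have hgap : (x + 1)⁻¹ - (y + 1)⁻¹ ≤ (1 - y)⁻¹ - (1 - x)⁻¹ := by
    rw [inv_sub_inv (by positivity) (by positivity), inv_sub_inv hy.ne' hx.ne']
    apply div_le_div₀ <;> nlinarith [mul_pos hy hx]
  have key := pow_sub_pow_le_pow_sub_pow (u₁ := (1 - x)⁻¹) (u₂ := (1 - y)⁻¹)
    (v₁ := (x + 1)⁻¹) (v₂ := (y + 1)⁻¹) (by positivity)
    (inv_anti₀ (by positivity) (by linarith)) (inv_anti₀ hx (by linarith))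
    (inv_anti₀ hy (by linarith)) hgap m
  simp only [inv_pow] at key
  linarith

/-- properties of `γ₃` on `(0,1)`: strictly increasing, `→ −∞` as `t → 0⁺`,
`→ +∞` as `t → 1⁻`, positive at `1/2`; hence a unique zero `t₁* ∈ (0, 1/2)`, with
`γ₃ < 0` on `(0, t₁*)` and `γ₃ > 0` on `(t₁*, 1)`. -/
theorem gamma3_properties (N : ℕ) (hN : 7 ≤ N)
    (γ : ℝ → ℝ)
    (hγ : ∀ t : ℝ, γ t = 1 / (1 - t ^ 2) ^ (N - 2) - 1 / (2 * t) ^ (N - 2) +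
        1 / (t ^ 2 + 1) ^ (N - 2)) :
    StrictMonoOn γ (Set.Ioo 0 1) ∧
    Filter.Tendsto γ (nhdsWithin 0 (Set.Ioi 0)) Filter.atBot ∧
    Filter.Tendsto γ (nhdsWithin 1 (Set.Iio 1)) Filter.atTop ∧
    0 < γ (1 / 2) ∧
    ∃ t₁ ∈ Set.Ioo (0 : ℝ) (1 / 2), γ t₁ = 0 ∧
      (∀ s ∈ Set.Ioo (0 : ℝ) (1 / 2), γ s = 0 → s = t₁) ∧
      (∀ t ∈ Set.Ioo (0 : ℝ) t₁, γ t < 0) ∧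
      ∀ t ∈ Set.Ioo t₁ 1, 0 < γ t := by
  have hm : N - 2 ≠ 0 := by omega
  generalize N - 2 = m at hγ hm
  simp only [one_div] at hγ
  obtain rfl : γ = fun t => ((1 - t ^ 2) ^ m)⁻¹ - ((2 * t) ^ m)⁻¹ + ((t ^ 2 + 1) ^ m)⁻¹ :=
    funext hγ
  clear hγ
  set γ : ℝ → ℝ := fun t => ((1 - t ^ 2) ^ m)⁻¹ - ((2 * t) ^ m)⁻¹ + ((t ^ 2 + 1) ^ m)⁻¹ with hγ
  have hmono : StrictMonoOn γ (Set.Ioo 0 1) := by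
    rintro x ⟨hx0, hx1⟩ y ⟨hy0, hy1⟩ hxy
    have hsum := monotoneOn_inv_one_sub_pow_add_inv_one_add_pow m (a := x ^ 2) (b := y ^ 2)
      ⟨by positivity, by nlinarith⟩ ⟨by positivity, by nlinarith⟩ (by nlinarith)
    have hinv : ((2 * y) ^ m)⁻¹ < ((2 * x) ^ m)⁻¹ :=
      inv_strictAnti₀ (by positivity) (pow_lt_pow_left₀ (by linarith) (by positivity) hm)
    simp only [hγ] at hsum ⊢
    linarith
  have hcont : ContinuousOn γ (Set.Ioo 0 1) := by
    rintro x ⟨hx0, hx1⟩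
    have h₁ : (1 - x ^ 2) ^ m ≠ 0 := pow_ne_zero _ (by nlinarith)
    have h₂ : (2 * x) ^ m ≠ 0 := by positivity
    have h₃ : (x ^ 2 + 1) ^ m ≠ 0 := by positivity
    apply ContinuousAt.continuousWithinAt
    fun_prop (disch := assumption)
  have hzero : Filter.Tendsto γ (nhdsWithin 0 (Set.Ioi 0)) Filter.atBot := by
    have hpow : Filter.Tendsto (fun t : ℝ => (2 * t) ^ m) (nhdsWithin 0 (Set.Ioi 0))
        (nhdsWithin 0 (Set.Ioi 0)) := by
      refine tendsto_nhdsWithin_iff.2 ⟨?_, ?_⟩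
      · have h : Continuous fun t : ℝ => (2 * t) ^ m := by fun_prop
        simpa [hm] using (h.tendsto 0).mono_left nhdsWithin_le_nhds
      · filter_upwards [self_mem_nhdsWithin] with t ht
        exact Set.mem_Ioi.2 (pow_pos (mul_pos two_pos (Set.mem_Ioi.1 ht)) m)
    have hrest : ContinuousAt (fun t : ℝ => ((1 - t ^ 2) ^ m)⁻¹ + ((t ^ 2 + 1) ^ m)⁻¹) 0 := by
      have h₁ : (1 - (0 : ℝ) ^ 2) ^ m ≠ 0 := by simp
      have h₃ : ((0 : ℝ) ^ 2 + 1) ^ m ≠ 0 := by simp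
      fun_prop (disch := assumption)
    refine ((Filter.tendsto_neg_atTop_atBot.comp
      (tendsto_inv_nhdsGT_zero.comp hpow)).atBot_add
        (hrest.tendsto.mono_left nhdsWithin_le_nhds)).congr fun t => ?_
    simp only [hγ, Function.comp_apply]
    ring
  have hone : Filter.Tendsto γ (nhdsWithin 1 (Set.Iio 1)) Filter.atTop := by
    have hpow : Filter.Tendsto (fun t : ℝ => (1 - t ^ 2) ^ m) (nhdsWithin 1 (Set.Iio 1))
        (nhdsWithin 0 (Set.Ioi 0)) := by
      refine tendsto_nhdsWithin_iff.2 ⟨?_, ?_⟩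
      · have h : Continuous fun t : ℝ => (1 - t ^ 2) ^ m := by fun_prop
        simpa [hm] using (h.tendsto 1).mono_left nhdsWithin_le_nhds
      · filter_upwards [Ioo_mem_nhdsLT (zero_lt_one' ℝ)] with t ht
        have h : 0 < 1 - t ^ 2 := by nlinarith [ht.1, ht.2]
        exact Set.mem_Ioi.2 (pow_pos h m)
    have hrest : ContinuousAt (fun t : ℝ => -((2 * t) ^ m)⁻¹ + ((t ^ 2 + 1) ^ m)⁻¹) 1 := by
      have h₂ : (2 * (1 : ℝ)) ^ m ≠ 0 := by positivity
      have h₃ : ((1 : ℝ) ^ 2 + 1) ^ m ≠ 0 := by positivity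
      fun_prop (disch := assumption)
    refine ((tendsto_inv_nhdsGT_zero.comp hpow).atTop_add
      (hrest.tendsto.mono_left nhdsWithin_le_nhds)).congr fun t => ?_
    simp only [hγ, Function.comp_apply]
    ring
  have hhalf : 0 < γ (1 / 2) := by
    have h₁ : (1 : ℝ) ≤ ((1 - (1 / 2) ^ 2) ^ m)⁻¹ :=
      one_le_inv₀ (by norm_num) |>.2 (pow_le_one₀ (by norm_num) (by norm_num))
    have h₂ : ((2 * (1 / 2) : ℝ) ^ m)⁻¹ = 1 := by norm_num
    have h₃ : (0 : ℝ) < (((1 / 2) ^ 2 + 1) ^ m)⁻¹ := by positivity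
    simp only [hγ]
    linarith
  refine ⟨hmono, hzero, hone, hhalf, ?_⟩
  obtain ⟨a, ha, ha0, ha2⟩ := ((hzero.eventually_lt_atBot 0).and
    (Ioo_mem_nhdsGT (one_half_pos (α := ℝ)))).exists
  obtain ⟨t₁, ⟨hat, ht2⟩, ht⟩ := intermediate_value_Ioo ha2.le
    (hcont.mono fun x hx => ⟨ha0.trans_le hx.1, hx.2.trans_lt one_half_lt_one⟩) ⟨ha, hhalf⟩
  have ht0 : 0 < t₁ := ha0.trans hat
  have ht1 : t₁ ∈ Set.Ioo (0 : ℝ) 1 := ⟨ht0, ht2.trans one_half_lt_one⟩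
  refine ⟨t₁, ⟨ht0, ht2⟩, ht, fun s hs hs0 => ?_, fun t h => ?_, fun t h => ?_⟩
  · exact hmono.injOn ⟨hs.1, hs.2.trans one_half_lt_one⟩ ht1 (hs0.trans ht.symm)
  · exact ht ▸ hmono ⟨h.1, h.2.trans ht1.2⟩ ht1 h.2
  · exact ht ▸ hmono ht1 ⟨ht0.trans h.1, h.2⟩ h.1
end

section
/- Let N ≥ 7 be an integer. The function t ↦ γ₃(t) − 2τ₁(t)² is strictly increasing on (0,1), tends to −∞ as t → 0⁺, tends to +∞ as t → 1⁻, and is strictly negative at t = 1/2. Consequently there exists a unique t₂* ∈ (1/2, 1) with γ₃(t₂*) − 2τ₁(t₂*)² = 0, and γ₃(t) − 2τ₁(t)² > 0 for all t ∈ (t₂*, 1). -/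
open Filter Topology Set

lemma pow_sub_pow_le_pow_sub_pow_s16 {a a' b b' : ℝ} (ha : 1 ≤ a) (haa : a ≤ a') (hb' : 0 ≤ b')
    (hbb : b' ≤ b) (hb : b ≤ 1) (h : b - b' ≤ a' - a) (m : ℕ) :
    b ^ m - b' ^ m ≤ a' ^ m - a ^ m := by
  induction m with
  | zero => simp
  | succ m ih =>
    have h₁ : b ^ m * (b - b') ≤ a' ^ m * (a' - a) :=
      calc b ^ m * (b - b') ≤ 1 * (b - b') :=
            mul_le_mul_of_nonneg_right (pow_le_one₀ (hb'.trans hbb) hb) (by linarith)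
        _ ≤ 1 * (a' - a) := by linarith
        _ ≤ a' ^ m * (a' - a) :=
            mul_le_mul_of_nonneg_right (one_le_pow₀ (ha.trans haa)) (by linarith)
    have h₂ : b' * (b ^ m - b' ^ m) ≤ a * (a' ^ m - a ^ m) :=
      mul_le_mul (by linarith) ih (sub_nonneg.2 (pow_le_pow_left₀ hb' hbb m)) (by linarith)
    linear_combination h₁ + h₂

/-- The even function `u ↦ (1 - u)⁻ᵐ + (1 + u)⁻ᵐ` is increasing on `[0, 1)`. -/
lemma monotoneOn_one_sub_pow_add_one_add_pow (m : ℕ) :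
    MonotoneOn (fun u : ℝ => 1 / (1 - u) ^ m + 1 / (u + 1) ^ m) (Ico 0 1) := by
  rintro u ⟨hu, hu'⟩ v ⟨hv, hv'⟩ huv
  have hu₁ : 0 < 1 - u := by linarith
  have hv₁ : 0 < 1 - v := by linarith
  have key : 1 / (u + 1) - 1 / (v + 1) ≤ 1 / (1 - v) - 1 / (1 - u) := by
    rw [div_sub_div _ _ (by positivity) (by positivity),
      div_sub_div _ _ hv₁.ne' hu₁.ne']
    apply div_le_div₀ <;> nlinarith [mul_pos hu₁ hv₁]
  have := pow_sub_pow_le_pow_sub_pow_s16 (one_le_one_div hu₁ (by linarith))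
    (one_div_le_one_div_of_le hv₁ (by linarith)) (by positivity)
    (one_div_le_one_div_of_le (by positivity) (by linarith))
    ((div_le_one (by positivity)).2 (by linarith)) key m
  simp only [one_div_pow] at this
  simp only
  linarith

lemma strictMonoOn_gamma_sub_tau_sq {m : ℕ} (hm : m ≠ 0) :
    StrictMonoOn (fun t : ℝ => 1 / (1 - t ^ 2) ^ m - 1 / (2 * t) ^ m + 1 / (t ^ 2 + 1) ^ m -
      2 * (1 / t ^ m - 1) ^ 2) (Ioo 0 1) := by
  rintro s ⟨hs, hs'⟩ t ⟨ht, ht'⟩ hst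
  have h₁ := monotoneOn_one_sub_pow_add_one_add_pow m (a := s ^ 2) (b := t ^ 2)
    ⟨by positivity, by nlinarith⟩ ⟨by positivity, by nlinarith⟩ (by nlinarith)
  have h₂ : 1 / (2 * t) ^ m < 1 / (2 * s) ^ m :=
    one_div_lt_one_div_of_lt (by positivity)
      (pow_lt_pow_left₀ (by linarith) (by positivity) hm)
  have h₃ : 1 / t ^ m ≤ 1 / s ^ m :=
    one_div_le_one_div_of_le (by positivity) (pow_le_pow_left₀ hs.le hst.le m)
  have h₄ : 1 ≤ 1 / t ^ m := one_le_one_div (by positivity) (pow_le_one₀ ht.le ht'.le)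
  have h₅ : (1 / t ^ m - 1) ^ 2 ≤ (1 / s ^ m - 1) ^ 2 :=
    pow_le_pow_left₀ (by linarith) (by linarith) 2
  simp only at h₁ ⊢
  linarith

lemma tendsto_gamma_sub_tau_sq_zero {m : ℕ} (hm : m ≠ 0) :
    Tendsto (fun t : ℝ => 1 / (1 - t ^ 2) ^ m - 1 / (2 * t) ^ m + 1 / (t ^ 2 + 1) ^ m -
      2 * (1 / t ^ m - 1) ^ 2) (𝓝[>] 0) atBot := by
  have h₁ : Tendsto (fun t : ℝ => 1 / (1 - t ^ 2) ^ m + 1 / (t ^ 2 + 1) ^ m) (𝓝[>] 0)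
      (𝓝 (1 / (1 - 0 ^ 2) ^ m + 1 / (0 ^ 2 + 1) ^ m)) := by
    have : ContinuousAt (fun t : ℝ => 1 / (1 - t ^ 2) ^ m + 1 / (t ^ 2 + 1) ^ m) 0 := by
      fun_prop (disch := norm_num)
    exact this.tendsto.mono_left nhdsWithin_le_nhds
  have h₂ : Tendsto (fun t : ℝ => 1 / t ^ m - 1) (𝓝[>] 0) atTop := by
    simp only [← one_div_pow]
    simp only [one_div]
    exact tendsto_atTop_add_const_right _ (-1)
      ((tendsto_pow_atTop hm).comp tendsto_inv_nhdsGT_zero)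
  have h₃ : Tendsto (fun t : ℝ => 2 * (1 / t ^ m - 1) ^ 2) (𝓝[>] 0) atTop :=
    ((tendsto_pow_atTop two_ne_zero).comp h₂).const_mul_atTop two_pos
  refine tendsto_atBot_mono' _ ?_ (h₁.add_atBot (tendsto_neg_atTop_atBot.comp h₃))
  filter_upwards [self_mem_nhdsWithin] with t ht
  have ht : 0 < t := ht
  have : 0 < 1 / (2 * t) ^ m := by positivity
  simp only [Function.comp_apply]
  linarith

lemma tendsto_gamma_sub_tau_sq_one {m : ℕ} (hm : m ≠ 0) :
    Tendsto (fun t : ℝ => 1 / (1 - t ^ 2) ^ m - 1 / (2 * t) ^ m + 1 / (t ^ 2 + 1) ^ m -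
      2 * (1 / t ^ m - 1) ^ 2) (𝓝[<] 1) atTop := by
  have h₁ : Tendsto (fun t : ℝ => -(1 / (2 * t) ^ m) + 1 / (t ^ 2 + 1) ^ m -
      2 * (1 / t ^ m - 1) ^ 2) (𝓝[<] 1)
      (𝓝 (-(1 / (2 * 1) ^ m) + 1 / (1 ^ 2 + 1) ^ m - 2 * (1 / 1 ^ m - 1) ^ 2)) := by
    have : ContinuousAt (fun t : ℝ => -(1 / (2 * t) ^ m) + 1 / (t ^ 2 + 1) ^ m -
        2 * (1 / t ^ m - 1) ^ 2) 1 := by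
      fun_prop (disch := norm_num)
    exact this.tendsto.mono_left nhdsWithin_le_nhds
  have h₂ : Tendsto (fun t : ℝ => 1 - t ^ 2) (𝓝[<] 1) (𝓝[>] 0) := by
    refine tendsto_nhdsWithin_iff.2 ⟨?_, ?_⟩
    · have : Continuous (fun t : ℝ => 1 - t ^ 2) := by fun_prop
      simpa using (this.tendsto 1).mono_left nhdsWithin_le_nhds
    · filter_upwards [Ioo_mem_nhdsLT (zero_lt_one' ℝ)] with t ht
      have := ht.1
      have := ht.2
      simp only [mem_Ioi]
      nlinarith
  have h₃ : Tendsto (fun t : ℝ => 1 / (1 - t ^ 2) ^ m) (𝓝[<] 1) atTop := by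
    simp only [← one_div_pow]
    simp only [one_div]
    exact (tendsto_pow_atTop hm).comp (tendsto_inv_nhdsGT_zero.comp h₂)
  refine (h₃.atTop_add h₁).congr fun t => ?_
  ring

lemma gamma_sub_tau_sq_half_neg {m : ℕ} (hm : 2 ≤ m) :
    1 / (1 - (1 / 2 : ℝ) ^ 2) ^ m - 1 / (2 * (1 / 2)) ^ m + 1 / ((1 / 2) ^ 2 + 1) ^ m -
      2 * (1 / (1 / 2) ^ m - 1) ^ 2 < 0 := by
  have h₁ : (4 / 3 : ℝ) ^ m ≤ 2 ^ m := pow_le_pow_left₀ (by norm_num) (by norm_num) m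
  have h₂ : (4 / 5 : ℝ) ^ m ≤ 1 := pow_le_one₀ (by norm_num) (by norm_num)
  have h₃ : (2 : ℝ) ^ 2 ≤ 2 ^ m := pow_le_pow_right₀ (by norm_num) hm
  simp only [← one_div_pow]
  norm_num
  nlinarith


/-- properties of `t ↦ γ₃(t) − 2τ₁(t)²` on `(0,1)`: strictly increasing,
`→ −∞` as `t → 0⁺`, `→ +∞` as `t → 1⁻`, negative at `1/2`; hence a unique zero
`t₂* ∈ (1/2, 1)`, positive on `(t₂*, 1)`. -/
theorem gamma3_minus_tau_sq_properties (N : ℕ) (hN : 7 ≤ N)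
    (τ γ : ℝ → ℝ)
    (hτ : ∀ t : ℝ, τ t = 1 / t ^ (N - 2) - 1)
    (hγ : ∀ t : ℝ, γ t = 1 / (1 - t ^ 2) ^ (N - 2) - 1 / (2 * t) ^ (N - 2) +
        1 / (t ^ 2 + 1) ^ (N - 2)) :
    StrictMonoOn (fun t => γ t - 2 * (τ t) ^ 2) (Set.Ioo 0 1) ∧
    Filter.Tendsto (fun t => γ t - 2 * (τ t) ^ 2) (nhdsWithin 0 (Set.Ioi 0)) Filter.atBot ∧
    Filter.Tendsto (fun t => γ t - 2 * (τ t) ^ 2) (nhdsWithin 1 (Set.Iio 1)) Filter.atTop ∧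
    γ (1 / 2) - 2 * (τ (1 / 2)) ^ 2 < 0 ∧
    ∃ t₂ ∈ Set.Ioo (1 / 2 : ℝ) 1, γ t₂ - 2 * (τ t₂) ^ 2 = 0 ∧
      (∀ s ∈ Set.Ioo (1 / 2 : ℝ) 1, γ s - 2 * (τ s) ^ 2 = 0 → s = t₂) ∧
      ∀ t ∈ Set.Ioo t₂ 1, 0 < γ t - 2 * (τ t) ^ 2 := by
  obtain ⟨m, hm⟩ : ∃ m, m = N - 2 := ⟨_, rfl⟩
  have hm₀ : m ≠ 0 := by omega
  simp only [hτ, hγ, ← hm]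
  have hmono := strictMonoOn_gamma_sub_tau_sq hm₀
  have hone := tendsto_gamma_sub_tau_sq_one hm₀
  have hhalf := gamma_sub_tau_sq_half_neg (m := m) (by omega)
  refine ⟨hmono, tendsto_gamma_sub_tau_sq_zero hm₀, hone, hhalf, ?_⟩
  obtain ⟨c, hc, hc₁, hc₂⟩ := ((hone.eventually_gt_atTop 0).and
    (Ioo_mem_nhdsLT (by norm_num : (1 / 2 : ℝ) < 1))).exists
  have hcont : ContinuousOn (fun t : ℝ => 1 / (1 - t ^ 2) ^ m - 1 / (2 * t) ^ m +
      1 / (t ^ 2 + 1) ^ m - 2 * (1 / t ^ m - 1) ^ 2) (Icc (1 / 2) c) := by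
    rintro t ⟨ht, htc⟩
    have ht₀ : t ≠ 0 := by linarith
    have ht₁ : 1 - t ^ 2 ≠ 0 := by nlinarith
    have ht₂ : t ^ 2 + 1 ≠ 0 := by positivity
    apply ContinuousAt.continuousWithinAt
    fun_prop (disch := positivity)
  obtain ⟨z, ⟨hz, hzc⟩, hz₀⟩ := intermediate_value_Ioo hc₁.le hcont ⟨hhalf, hc⟩
  have hz_mem : z ∈ Ioo (0 : ℝ) 1 := ⟨by linarith, by linarith⟩
  refine ⟨z, ⟨hz, by linarith⟩, hz₀, fun s hs hs₀ => ?_, fun t ht => ?_⟩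
  · exact hmono.injOn ⟨by linarith [hs.1], hs.2⟩ hz_mem (hs₀.trans hz₀.symm)
  · exact hz₀.symm.trans_lt (hmono hz_mem ⟨by linarith [ht.1], ht.2⟩ ht.1)
end

section
/- Let N ≥ 7 be an integer and let t₁* ∈ (0, 1/2) be the unique zero of γ₃ in (0,1), so that γ₃(t₁*) = 0 and γ₃(t) < 0 for t ∈ (0, t₁*). Then the function ι₃ satisfies: ι₃(t) → −∞ as t → 0⁺, ι₃(t₁*) > 0, and in particular there exists t₀ ∈ (0, t₁*) with ι₃(t₀) = 0. Here ι₃(t) = γ₃′(t)·(2γ₃(t)(γ₃(t) − 2τ₁(t)²) + τ₁(t)²(γ₃(t) + 2γ₄(t))) − 2τ₁′(t)τ₁(t)γ₃(t)(γ₃(t) + 2γ₄(t)) + 4γ₄′(t)γ₃(t)(γ₃(t) − 2τ₁(t)²). -/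
open Set Filter Topology

section PoleAtZero

variable {f r : ℝ → ℝ} {c : ℝ} {m : ℕ}

/-- A function with a pole `c / t ^ m` at the origin and `C¹` remainder is `C¹` on `(0, 1)`. -/
theorem contDiffOn_of_pole (hr : ContDiffOn ℝ 1 r (Ioo (-1) 1))
    (hf : ∀ t, f t = c * (t ^ m)⁻¹ + r t) : ContDiffOn ℝ 1 f (Ioo 0 1) := by
  rw [funext hf]
  refine ContDiffOn.add (contDiffOn_const.mul (ContDiffOn.inv (by fun_prop) ?_))
    (hr.mono (Ioo_subset_Ioo_left (by norm_num)))
  exact fun t ht => pow_ne_zero _ ht.1.ne'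

theorem tendsto_pow_mul_of_pole (hm : m ≠ 0) (hr : ContDiffOn ℝ 1 r (Ioo (-1) 1))
    (hf : ∀ t, f t = c * (t ^ m)⁻¹ + r t) :
    Tendsto (fun t => t ^ m * f t) (𝓝[>] 0) (𝓝 c) := by
  have hr0 : ContinuousAt r 0 :=
    hr.continuousOn.continuousAt (Ioo_mem_nhds (by norm_num) (by norm_num))
  have h : Tendsto (fun t => c + t ^ m * r t) (𝓝[>] 0) (𝓝 c) := by
    have : ContinuousAt (fun t => c + t ^ m * r t) 0 := by fun_prop
    simpa [hm] using this.tendsto.mono_left nhdsWithin_le_nhds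
  refine h.congr' ?_
  filter_upwards [self_mem_nhdsWithin] with t ht
  have : t ^ m ≠ 0 := pow_ne_zero _ (ne_of_gt ht)
  rw [hf]
  field_simp

theorem tendsto_pow_mul_deriv_of_pole (hr : ContDiffOn ℝ 1 r (Ioo (-1) 1))
    (hf : ∀ t, f t = c * (t ^ m)⁻¹ + r t) :
    Tendsto (fun t => t ^ (m + 1) * deriv f t) (𝓝[>] 0) (𝓝 (-(c * m))) := by
  have hr0 : ContinuousAt (deriv r) 0 :=
    (hr.continuousOn_deriv_of_isOpen isOpen_Ioo le_rfl).continuousAt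
      (Ioo_mem_nhds (by norm_num) (by norm_num))
  have h : Tendsto (fun t => -(c * m) + t ^ (m + 1) * deriv r t) (𝓝[>] 0) (𝓝 (-(c * m))) := by
    have : ContinuousAt (fun t => -(c * m) + t ^ (m + 1) * deriv r t) 0 := by fun_prop
    simpa using this.tendsto.mono_left nhdsWithin_le_nhds
  refine h.congr' ?_
  filter_upwards [Ioo_mem_nhdsGT (zero_lt_one' ℝ)] with t ht
  have ht0 : t ≠ 0 := ht.1.ne'
  have hrt : DifferentiableAt ℝ r t := (hr.differentiableOn one_ne_zero).differentiableAt
    (Ioo_mem_nhds (by linarith [ht.1]) ht.2)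
  have hd : HasDerivAt f (c * (-(m * t ^ (m - 1)) / (t ^ m) ^ 2) + deriv r t) t := by
    rw [funext hf]
    exact (((hasDerivAt_pow m t).fun_inv (pow_ne_zero _ ht0)).const_mul c).add hrt.hasDerivAt
  rw [hd.deriv]
  rcases m with _ | k
  · simp
  · simp only [Nat.add_sub_cancel]
    field_simp
    ring

end PoleAtZero


/-- with `t₁* ∈ (0,1/2)` the unique zero of `γ₃` in `(0,1)`, and `γ₃ < 0`
on `(0, t₁*)`, the function `ι₃` tends to `−∞` as `t → 0⁺`, is positive at `t₁*`, and
hence has a zero `t₀ ∈ (0, t₁*)`. -/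
theorem iota3_has_zero (N : ℕ) (hN : 7 ≤ N)
    (τ γ₃ γ₄ ι : ℝ → ℝ)
    (hτ : ∀ t : ℝ, τ t = 1 / t ^ (N - 2) - 1)
    (hγ₃ : ∀ t : ℝ, γ₃ t = 1 / (1 - t ^ 2) ^ (N - 2) - 1 / (2 * t) ^ (N - 2) +
        1 / (t ^ 2 + 1) ^ (N - 2))
    (hγ₄ : ∀ t : ℝ, γ₄ t = 1 / (Real.sqrt 2 * t) ^ (N - 2) -
        1 / (t ^ 4 + 1) ^ (((N : ℝ) - 2) / 2))
    (hι : ∀ t : ℝ, ι t =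
        deriv γ₃ t * (2 * γ₃ t * (γ₃ t - 2 * (τ t) ^ 2) + (τ t) ^ 2 * (γ₃ t + 2 * γ₄ t)) -
          2 * deriv τ t * τ t * γ₃ t * (γ₃ t + 2 * γ₄ t) +
          4 * deriv γ₄ t * γ₃ t * (γ₃ t - 2 * (τ t) ^ 2))
    (t₁ : ℝ) (ht₁ : t₁ ∈ Set.Ioo (0 : ℝ) (1 / 2))
    (hzero : γ₃ t₁ = 0)
    (huniq : ∀ t ∈ Set.Ioo (0 : ℝ) 1, γ₃ t = 0 → t = t₁)
    (hneg : ∀ t ∈ Set.Ioo (0 : ℝ) t₁, γ₃ t < 0) :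
    Filter.Tendsto ι (nhdsWithin 0 (Set.Ioi 0)) Filter.atBot ∧
    0 < ι t₁ ∧
    ∃ t₀ ∈ Set.Ioo (0 : ℝ) t₁, ι t₀ = 0 := by
  obtain ⟨m, rfl⟩ : ∃ m, N = m + 2 := ⟨N - 2, by omega⟩
  have hm : m ≠ 0 := by omega
  simp only [Nat.add_sub_cancel] at hτ hγ₃ hγ₄
  push_cast at hγ₄
  simp only [add_sub_cancel_right] at hγ₄
  set a : ℝ := (2 ^ m)⁻¹ with ha
  set b : ℝ := (√2 ^ m)⁻¹ with hb
  have ha0 : 0 < a := by positivity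
  have hab : a ≤ b := by
    have h2 : √2 ≤ 2 := by rw [Real.sqrt_le_left (by norm_num)]; norm_num
    rw [ha, hb]
    gcongr
  have hτ' : ∀ t, τ t = 1 * (t ^ m)⁻¹ + (-1) := fun t => by rw [hτ]; ring
  have hγ₃' : ∀ t, γ₃ t = (-a) * (t ^ m)⁻¹ +
      (((1 - t ^ 2) ^ m)⁻¹ + ((t ^ 2 + 1) ^ m)⁻¹) := fun t => by
    rw [hγ₃, mul_pow, ha]; simp only [one_div, mul_inv]; ring
  have hγ₄' : ∀ t, γ₄ t = b * (t ^ m)⁻¹ + -((t ^ 4 + 1) ^ ((m : ℝ) / 2))⁻¹ := fun t => by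
    rw [hγ₄, mul_pow, hb]; simp only [one_div, mul_inv]; ring
  have rτ : ContDiffOn ℝ 1 (fun _ : ℝ => (-1 : ℝ)) (Ioo (-1) 1) := contDiffOn_const
  have rγ₃ : ContDiffOn ℝ 1 (fun t : ℝ => ((1 - t ^ 2) ^ m)⁻¹ + ((t ^ 2 + 1) ^ m)⁻¹)
      (Ioo (-1) 1) := by
    refine (ContDiffOn.inv (by fun_prop) fun t ht => pow_ne_zero _ ?_).add
      (ContDiffOn.inv (by fun_prop) fun t _ => by positivity)
    nlinarith [ht.1, ht.2]
  have rγ₄ : ContDiffOn ℝ 1 (fun t : ℝ => -((t ^ 4 + 1) ^ ((m : ℝ) / 2))⁻¹) (Ioo (-1) 1) := by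
    refine (ContDiffOn.inv (ContDiffOn.rpow_const_of_ne (by fun_prop) fun t _ => by positivity)
      fun t _ => by positivity).neg
  have hlim : Tendsto ι (𝓝[>] 0) atBot := by
    have Lτ := tendsto_pow_mul_of_pole hm rτ hτ'
    have L₃ := tendsto_pow_mul_of_pole hm rγ₃ hγ₃'
    have L₄ := tendsto_pow_mul_of_pole hm rγ₄ hγ₄'
    have Dτ := tendsto_pow_mul_deriv_of_pole rτ hτ'
    have D₃ := tendsto_pow_mul_deriv_of_pole rγ₃ hγ₃'
    have D₄ := tendsto_pow_mul_deriv_of_pole rγ₄ hγ₄'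
    have Lm : Tendsto (fun t : ℝ => t ^ m) (𝓝[>] 0) (𝓝 0) := by
      simpa [hm] using ((continuous_pow (M := ℝ) m).tendsto 0).mono_left nhdsWithin_le_nhds
    have LB := (Lm.mul L₃).sub ((Lτ.pow 2).const_mul 2)
    have LC := L₃.add (L₄.const_mul 2)
    have L := ((D₃.mul (((L₃.const_mul 2).mul LB).add ((Lτ.pow 2).mul LC))).sub
      ((((Dτ.const_mul 2).mul Lτ).mul L₃).mul LC)).add (((D₄.const_mul 4).mul L₃).mul LB)
    have hinv : Tendsto (fun t : ℝ => (t ^ (4 * m + 1))⁻¹) (𝓝[>] 0) atTop := by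
      refine tendsto_inv_nhdsGT_zero.comp (tendsto_nhdsWithin_iff.2 ⟨?_, ?_⟩)
      · simpa using
          ((continuous_pow (M := ℝ) (4 * m + 1)).tendsto 0).mono_left nhdsWithin_le_nhds
      · filter_upwards [self_mem_nhdsWithin] with t ht
        exact pow_pos (mem_Ioi.1 ht) _
    refine (L.neg_mul_atTop ?_ hinv).congr' ?_
    · have hm0 : (0 : ℝ) < m := by positivity
      have : 0 < a * m * (2 * b - a) := by
        have : 0 < 2 * b - a := by linarith
        positivity
      linarith
    · filter_upwards [self_mem_nhdsWithin] with t ht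
      have ht0 : t ≠ 0 := ne_of_gt ht
      rw [hι]
      field_simp
      ring
  have ht0 : 0 < t₁ := ht₁.1
  have ht1 : t₁ < 1 := by linarith [ht₁.2]
  have hpos : 0 < ι t₁ := by
    have hd : 0 < deriv γ₃ t₁ := by
      have h1 : 0 < 1 - t₁ ^ 2 := by nlinarith
      have h2 : 0 < t₁ ^ 2 + 1 := by positivity
      have hD : HasDerivAt γ₃ (m * a / t₁ ^ (m + 1) +
          2 * m * t₁ * (((1 - t₁ ^ 2) ^ (m + 1))⁻¹ - ((t₁ ^ 2 + 1) ^ (m + 1))⁻¹)) t₁ := by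
        rw [funext hγ₃']
        have e1 := (((hasDerivAt_pow m t₁).fun_inv (pow_ne_zero _ ht0.ne')).const_mul (-a))
        have e2 := ((((hasDerivAt_pow 2 t₁).const_sub 1).fun_pow m).fun_inv
          (pow_ne_zero _ h1.ne'))
        have e3 := ((((hasDerivAt_pow 2 t₁).add_const 1).fun_pow m).fun_inv
          (pow_ne_zero _ h2.ne'))
        refine (e1.add (e2.add e3)).congr_deriv ?_
        obtain ⟨k, rfl⟩ := Nat.exists_eq_succ_of_ne_zero hm
        simp only [Nat.succ_eq_add_one, Nat.add_sub_cancel]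
        have h1' := h1.ne'
        field_simp
        push_cast
        ring
      rw [hD.deriv]
      have hle : ((t₁ ^ 2 + 1) ^ (m + 1))⁻¹ ≤ ((1 - t₁ ^ 2) ^ (m + 1))⁻¹ := by
        gcongr
        nlinarith
      have := sub_nonneg.2 hle
      have hm0 : (0 : ℝ) < m := by positivity
      positivity
    have hg : 0 < γ₄ t₁ := by
      have hbase : (√2 * t₁) ^ m < (t₁ ^ 4 + 1) ^ ((m : ℝ) / 2) := by
        have hs : (t₁ ^ 4 + 1) ^ ((m : ℝ) / 2) = √(t₁ ^ 4 + 1) ^ m := by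
          rw [Real.rpow_div_two_eq_sqrt _ (by positivity), Real.rpow_natCast]
        rw [hs]
        refine pow_lt_pow_left₀ (Real.lt_sqrt_of_sq_lt ?_) (by positivity) hm
        rw [mul_pow, Real.sq_sqrt (by norm_num)]
        have : t₁ ^ 2 < 1 := by nlinarith
        nlinarith [sq_pos_of_pos (sub_pos.2 this)]
      rw [hγ₄, sub_pos]
      exact one_div_lt_one_div_of_lt (by positivity) hbase
    have hτ0 : τ t₁ ≠ 0 := by
      rw [hτ, sub_ne_zero]
      exact (one_lt_one_div (by positivity) (pow_lt_one₀ ht0.le ht1 hm)).ne'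
    rw [hι, hzero]
    have : 0 < deriv γ₃ t₁ * (τ t₁ ^ 2 * (2 * γ₄ t₁)) := by positivity
    linarith
  refine ⟨hlim, hpos, ?_⟩
  have hcont : ContinuousOn ι (Ioo 0 1) := by
    have cτ := contDiffOn_of_pole rτ hτ'
    have c₃ := contDiffOn_of_pole rγ₃ hγ₃'
    have c₄ := contDiffOn_of_pole rγ₄ hγ₄'
    have dτ := cτ.continuousOn_deriv_of_isOpen isOpen_Ioo le_rfl
    have d₃ := c₃.continuousOn_deriv_of_isOpen isOpen_Ioo le_rfl
    have d₄ := c₄.continuousOn_deriv_of_isOpen isOpen_Ioo le_rfl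
    have cτ := cτ.continuousOn
    have c₃ := c₃.continuousOn
    have c₄ := c₄.continuousOn
    rw [funext hι]
    fun_prop
  obtain ⟨s, hs, hs0⟩ := ((hlim.eventually_lt_atBot 0).and (Ioo_mem_nhdsGT ht0)).exists
  obtain ⟨t₀, ht₀, h⟩ := intermediate_value_Ioo hs0.2.le
    (hcont.mono fun x hx => ⟨hs0.1.trans_le hx.1, hx.2.trans_lt ht1⟩) ⟨hs, hpos⟩
  exact ⟨t₀, ⟨hs0.1.trans ht₀.1, ht₀.2⟩, h⟩
end
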